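/- arXiv:2212.14500 — 5 statements merged into one kernel-verified Lean document; each statement's English description precedes it below -/
import Mathlib

section
/- Let X be a Banach space and let S be a nonempty, closed, convex, and bounded subset of X. Let A : S → X and B : S → X be two operators such that: (a) A is a nonlinear D-contraction, i.e., there is a D-function φ with φ(t) < t for all t > 0 and ‖Au − Av‖ ≤ φ(‖u − v‖) for all u, v ∈ S; (b) B is completely continuous, i.e., B is continuous and B(S) is relatively compact in X; (c) Au + Bv ∈ S for all u, v ∈ S. Then there exists u ∈ S such that Au + Bu = u. -/
open Set Filter Topology

namespace HMDEPaper

/-- `ℝⁿ` with the Euclidean norm. -/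
abbrev En (n : ℕ) := EuclideanSpace ℝ (Fin n)

section Defs

variable {E : Type*} [NormedAddCommGroup E]

/-- `f` is regulated on the interval `[a, b]`: one-sided limits exist at every point. -/
def RegulatedOn (f : ℝ → E) (a b : ℝ) : Prop :=
  (∀ t ∈ Set.Ioc a b, ∃ L, Filter.Tendsto f (nhdsWithin t (Set.Ico a t)) (nhds L)) ∧
  (∀ t ∈ Set.Ico a b, ∃ L, Filter.Tendsto f (nhdsWithin t (Set.Ioc t b)) (nhds L))

/-- `f` is regulated on `[0, ∞)`: one-sided limits exist at every point. -/
def RegulatedOnIci (f : ℝ → E) : Prop :=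
  (∀ t : ℝ, 0 < t → ∃ L, Filter.Tendsto f (nhdsWithin t (Set.Ico 0 t)) (nhds L)) ∧
  (∀ t : ℝ, 0 ≤ t → ∃ L, Filter.Tendsto f (nhdsWithin t (Set.Ioi t)) (nhds L))

/-- A family `F` of functions is equiregulated on `[a, b]`. -/
def EquiregulatedOn (F : Set (ℝ → E)) (a b : ℝ) : Prop :=
  ∀ ε : ℝ, 0 < ε →
    (∀ τ ∈ Set.Ioc a b, ∃ δ > (0 : ℝ), ∀ y ∈ F, ∀ L,
      Filter.Tendsto y (nhdsWithin τ (Set.Ico a τ)) (nhds L) →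
      ∀ t ∈ Set.Ico a τ, τ - δ < t → ‖y t - L‖ < ε) ∧
    (∀ τ ∈ Set.Ico a b, ∃ δ > (0 : ℝ), ∀ y ∈ F, ∀ L,
      Filter.Tendsto y (nhdsWithin τ (Set.Ioc τ b)) (nhds L) →
      ∀ t ∈ Set.Ioc τ b, t < τ + δ → ‖y t - L‖ < ε)

/-- A D-function: continuous, nondecreasing on `[0, ∞)`, vanishing at `0`, positive on `(0, ∞)`. -/
def IsDFunction (φ : ℝ → ℝ) : Prop :=
  ContinuousOn φ (Set.Ici 0) ∧ MonotoneOn φ (Set.Ici 0) ∧ φ 0 = 0 ∧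
    ∀ s : ℝ, 0 < s → 0 < φ s

/-- `g` is left-continuous at every point of `(a, b]`. -/
def LeftContinuousOn (g : ℝ → ℝ) (a b : ℝ) : Prop :=
  ∀ t ∈ Set.Ioc a b, Filter.Tendsto g (nhdsWithin t (Set.Ico a t)) (nhds (g t))

/-- A bounded regulated function on `[0, ∞)` which is S-asymptotically `ω`-periodic. -/
def SAsympPeriodic (ω : ℝ) (x : ℝ → E) : Prop :=
  (∃ C : ℝ, ∀ t : ℝ, 0 ≤ t → ‖x t‖ ≤ C) ∧ RegulatedOnIci x ∧
    Filter.Tendsto (fun t => x (t + ω) - x t) Filter.atTop (nhds 0)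

end Defs

section KS

/-- A tagged partition of `[a, b]`. -/
structure TaggedPartition (a b : ℝ) where
  n : ℕ
  npos : 0 < n
  s : ℕ → ℝ
  τ : ℕ → ℝ
  s_first : s 0 = a
  s_last : s n = b
  s_mono : ∀ i < n, s i ≤ s (i + 1)
  tag_mem : ∀ i < n, τ i ∈ Set.Icc (s i) (s (i + 1))

/-- A tagged partition is `δ`-fine for a gauge `δ`. -/
def TaggedPartition.IsFine {a b : ℝ} (P : TaggedPartition a b) (δ : ℝ → ℝ) : Prop :=
  ∀ i < P.n,
    Set.Icc (P.s i) (P.s (i + 1)) ⊆ Set.Ioo (P.τ i - δ (P.τ i)) (P.τ i + δ (P.τ i))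

variable {E : Type*} [NormedAddCommGroup E] [NormedSpace ℝ E]

/-- The Kurzweil–Stieltjes Riemann sum of `f` w.r.t. `g` over a tagged partition. -/
def TaggedPartition.sum {a b : ℝ} (P : TaggedPartition a b) (f : ℝ → E) (g : ℝ → ℝ) : E :=
  ∑ i ∈ Finset.range P.n, (g (P.s (i + 1)) - g (P.s i)) • f (P.τ i)

/-- `I` is the Kurzweil–Stieltjes integral of `f` w.r.t. `g` over `[a, b]`. -/
def HasKSIntegral (f : ℝ → E) (g : ℝ → ℝ) (a b : ℝ) (I : E) : Prop :=
  ∀ ε : ℝ, 0 < ε → ∃ δ : ℝ → ℝ, (∀ t, 0 < δ t) ∧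
    ∀ P : TaggedPartition a b, P.IsFine δ → ‖P.sum f g - I‖ < ε

/-- `f` is Kurzweil–Stieltjes integrable w.r.t. `g` over `[a, b]`. -/
def KSIntegrable (f : ℝ → E) (g : ℝ → ℝ) (a b : ℝ) : Prop :=
  ∃ I, HasKSIntegral f g a b I

/-- A solution of the hybrid measure differential equation on `[t₀, t₀ + a]`
with data `(h, f, g, x₀)`. -/
def IsHMDESolution (h f : ℝ → E → E) (g : ℝ → ℝ) (t₀ a : ℝ) (x₀ : E) (x : ℝ → E) : Prop :=
  RegulatedOn x t₀ (t₀ + a) ∧ x t₀ = x₀ ∧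
  RegulatedOn (fun t => h t (x t)) t₀ (t₀ + a) ∧
  ∃ I : ℝ → E,
    (∀ t ∈ Set.Icc t₀ (t₀ + a), HasKSIntegral (fun s => f s (x s)) g t₀ t (I t)) ∧
    (∀ t ∈ Set.Icc t₀ (t₀ + a), x t = x₀ - h t₀ x₀ + h t (x t) + I t)

end KS

end HMDEPaper

namespace HMDEPaper

section Brouwer

/-- The determinant of `id + t • L` is a polynomial in `t` of degree at most the dimension. -/
theorem exists_polynomial_eval_eq_det_id_add_smul
    {E : Type*} [NormedAddCommGroup E] [NormedSpace ℝ E] [FiniteDimensional ℝ E] (L : E →L[ℝ] E) :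
    ∃ p : Polynomial ℝ, p.natDegree ≤ Module.finrank ℝ E ∧
      ∀ t : ℝ, p.eval t = (ContinuousLinearMap.id ℝ E + t • L).det := by
  classical
  let b := Module.finBasis ℝ E
  let M := LinearMap.toMatrix b b (L : E →ₗ[ℝ] E)
  refine ⟨_, (Polynomial.natDegree_det_X_add_C_le M 1).trans_eq (Fintype.card_fin _), fun t => ?_⟩
  rw [ContinuousLinearMap.det, ← LinearMap.det_toMatrix b, ← Polynomial.coe_evalRingHom,
    RingHom.map_det]
  congr 1
  ext i j
  rcases eq_or_ne i j with rfl | hij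
  · simp [M]
    ring
  · simp [M, hij]
    ring

/-- The Lagrange formula for a polynomial of degree less than `k`, with `k` distinct nodes. -/
theorem eq_sum_lagrange_basis_eval {k : ℕ} {v : ℕ → ℝ} (hv : Function.Injective v)
    {p : Polynomial ℝ} (hp : p.natDegree < k) (t : ℝ) :
    p.eval t =
      ∑ i ∈ Finset.range k, p.eval (v i) * (Lagrange.basis (Finset.range k) v i).eval t := by
  have h := Lagrange.eq_interpolate (s := Finset.range k) (v := v) (f := p) hv.injOn
    (by
      rw [Finset.card_range]
      exact lt_of_le_of_lt Polynomial.degree_le_natDegree (by exact_mod_cast hp))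
  conv_lhs => rw [h, Lagrange.interpolate_apply]
  simp [Polynomial.eval_finsetSum]

/-- A perturbation of the identity by a map with small Lipschitz constant is bijective. -/
theorem bijective_id_add_of_lipschitzWith {E : Type*} [NormedAddCommGroup E] [CompleteSpace E]
    {K : NNReal} {g : E → E} (hg : LipschitzWith K g) (hK : K < 1) :
    Function.Bijective fun x => x + g x := by
  constructor
  · intro x y hxy
    by_contra hne
    have h1 := hg.dist_le_mul x y
    have h2 : dist (g x) (g y) = dist x y := by
      rw [dist_eq_norm, dist_eq_norm, ← norm_neg (x - y)]
      congr 1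
      have : x + g x = y + g y := hxy
      rw [eq_sub_of_add_eq' this]
      abel
    have h3 : (K : ℝ) < 1 := by exact_mod_cast hK
    nlinarith [dist_pos.2 hne]
  · intro y
    have hc : ContractingWith K fun x => y - g x :=
      ⟨hK, LipschitzWith.of_dist_le_mul fun a b => by
        rw [dist_sub_left]; exact hg.dist_le_mul a b⟩
    refine ⟨ContractingWith.fixedPoint _ hc, ?_⟩
    have h : y - g _ = _ := hc.fixedPoint_isFixedPt
    exact (sub_eq_iff_eq_add.1 h).symm

/-- A map that is Lipschitz on a closed ball and vanishes on its boundary sphere extends by zero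
to a Lipschitz map. -/
theorem lipschitzWith_indicator_closedBall {E F : Type*} [NormedAddCommGroup E] [NormedSpace ℝ E]
    [NormedAddCommGroup F] {R : ℝ} {K : NNReal} {g : E → F}
    (hg : LipschitzOnWith K g (Metric.closedBall 0 R)) (h0 : ∀ x, ‖x‖ = R → g x = 0) :
    LipschitzWith K ((Metric.closedBall (0 : E) R).indicator g) := by
  have key : ∀ x y : E, ‖x‖ ≤ R → R < ‖y‖ → ‖g x‖ ≤ K * ‖x - y‖ := by
    intro x y hx hy
    have hcont : ContinuousOn (fun s : ℝ => ‖x + s • (y - x)‖) (Icc 0 1) := by fun_prop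
    obtain ⟨s, hs, hsR⟩ := intermediate_value_Icc zero_le_one hcont
      (show R ∈ Icc _ _ by simpa using ⟨hx, hy.le⟩)
    have h1 := hg.dist_le_mul x (by simpa using hx) (x + s • (y - x))
      (by simpa using (show ‖x + s • (y - x)‖ = R from hsR).le)
    rw [h0 _ hsR, dist_zero_right, dist_self_add_right, norm_smul, Real.norm_of_nonneg hs.1,
      norm_sub_rev] at h1
    refine h1.trans (mul_le_mul_of_nonneg_left ?_ K.2)
    exact mul_le_of_le_one_left (norm_nonneg _) hs.2
  refine LipschitzWith.of_dist_le_mul fun x y => ?_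
  by_cases hx : x ∈ Metric.closedBall (0 : E) R <;> by_cases hy : y ∈ Metric.closedBall (0 : E) R
  · rw [indicator_of_mem hx, indicator_of_mem hy]
    exact hg.dist_le_mul x hx y hy
  · rw [indicator_of_mem hx, indicator_of_notMem hy, dist_zero_right, dist_eq_norm]
    exact key x y (by simpa using hx) (by simpa using hy)
  · rw [indicator_of_notMem hx, indicator_of_mem hy, dist_zero_left, dist_comm, dist_eq_norm]
    exact key y x (by simpa using hy) (by simpa using hx)
  · rw [indicator_of_notMem hx, indicator_of_notMem hy, dist_self]
    positivity

variable {E : Type*} [NormedAddCommGroup E] [InnerProductSpace ℝ E] [FiniteDimensional ℝ E]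

/-- The derivative of a map of locally constant nonzero norm is singular. -/
theorem det_fderiv_eq_zero_of_eventually_norm_eq {r : E → E} {x : E} {R : ℝ}
    (hr : DifferentiableAt ℝ r x) (hR : 0 < R) (h : ∀ᶠ y in 𝓝 x, ‖r y‖ = R) :
    (fderiv ℝ r x).det = 0 := by
  by_contra hdet
  have hd := hr.hasFDerivAt.norm_sq
  have hz : HasFDerivAt (fun y => ‖r y‖ ^ 2) (0 : E →L[ℝ] ℝ) x :=
    (hasFDerivAt_const (R ^ 2) x).congr_of_eventuallyEq (h.mono fun y hy => by simp [hy])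
  obtain ⟨v, hv⟩ := (LinearMap.equivOfDetNeZero _ hdet).surjective (r x)
  have hv' : fderiv ℝ r x v = r x := hv
  have := congrArg (fun L : E →L[ℝ] ℝ => L v) (hd.unique hz)
  have hx : ‖r x‖ = R := h.self_of_nhds
  simp [hv', hx, hR.ne'] at this

open MeasureTheory in
/-- For a `C¹` perturbation of the identity that maps a ball into itself and fixes its boundary,
the integral of the Jacobian over the ball is its volume, for small perturbations. -/
theorem exists_forall_integral_det_eq_volume [MeasurableSpace E] [BorelSpace E]
    {r : E → E} (hr : ContDiff ℝ 1 r) {R : ℝ}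
    (h1 : ∀ x, ‖x‖ ≤ R → ‖r x‖ ≤ R) (h2 : ∀ x, ‖x‖ = R → r x = x) :
    ∃ ε > 0, ∀ t : ℝ, 0 ≤ t → t < ε →
      ∫ x in Metric.ball (0 : E) R,
        (ContinuousLinearMap.id ℝ E + t • (fderiv ℝ r x - ContinuousLinearMap.id ℝ E)).det
        = volume.real (Metric.ball (0 : E) R) := by
  set D : E → E →L[ℝ] E := fun x => fderiv ℝ r x - ContinuousLinearMap.id ℝ E with hD
  have hDc : Continuous D := (hr.continuous_fderiv one_ne_zero).sub continuous_const
  have hgd : ∀ x, HasFDerivAt (fun x => r x - x) (D x) x := fun x =>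
    ((hr.differentiable one_ne_zero x).hasFDerivAt).sub (hasFDerivAt_id x)
  obtain ⟨C', hC'⟩ := (isCompact_closedBall (0 : E) R).exists_bound_of_continuousOn hDc.continuousOn
  obtain ⟨C, hC0, hC⟩ : ∃ C : NNReal, 0 < (C : ℝ) ∧ ∀ x ∈ Metric.closedBall (0 : E) R, ‖D x‖ ≤ C :=
    ⟨NNReal.mk (max C' 1) (by positivity), by rw [NNReal.coe_mk]; positivity,
      fun x hx => (hC' x hx).trans (le_max_left _ _)⟩
  have hLip : LipschitzOnWith C (fun x => r x - x) (Metric.closedBall 0 R) := by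
    refine Convex.lipschitzOnWith_of_nnnorm_fderiv_le (𝕜 := ℝ)
      (fun x _ => (hgd x).differentiableAt) (fun x hx => ?_) (convex_closedBall _ _)
    rw [(hgd x).fderiv]
    exact hC x hx
  have hG := lipschitzWith_indicator_closedBall hLip (fun x hx => by rw [h2 x hx, sub_self])
  have hdet : ∀ᶠ L in 𝓝 (0 : E →L[ℝ] E), 0 < (ContinuousLinearMap.id ℝ E + L).det := by
    have hc : Continuous fun L : E →L[ℝ] E => (ContinuousLinearMap.id ℝ E + L).det :=
      ContinuousLinearMap.continuous_det.comp (continuous_const.add continuous_id)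
    refine hc.continuousAt.eventually (lt_mem_nhds ?_)
    simp [ContinuousLinearMap.det]
  obtain ⟨δ, hδ, hdet⟩ := Metric.eventually_nhds_iff.1 hdet
  refine ⟨min (δ / C) (min 1 C⁻¹), by positivity, fun t ht0 ht => ?_⟩
  obtain ⟨htδ, ht1, htC⟩ : t < δ / C ∧ t < 1 ∧ t < C⁻¹ := by simpa using ht
  have htC' : t * C < 1 := (lt_div_iff₀ hC0).1 (by rwa [one_div])
  set f : E → E := fun x => x + t • (r x - x) with hf
  have hbij : Function.Bijective fun x =>
      x + t • (Metric.closedBall (0 : E) R).indicator (fun x => r x - x) x := by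
    refine bijective_id_add_of_lipschitzWith (K := t.toNNReal * C) ?_ ?_
    · refine LipschitzWith.of_dist_le_mul fun x y => ?_
      rw [dist_smul₀, NNReal.coe_mul, Real.coe_toNNReal _ ht0, mul_assoc,
        Real.norm_of_nonneg ht0]
      exact mul_le_mul_of_nonneg_left (hG.dist_le_mul x y) ht0
    · rwa [← NNReal.coe_lt_coe, NNReal.coe_mul, Real.coe_toNNReal _ ht0, NNReal.coe_one]
  have hfeq : ∀ x ∈ Metric.ball (0 : E) R, x + t • (Metric.closedBall (0 : E) R).indicator
      (fun x => r x - x) x = f x := fun x hx => by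
    rw [indicator_of_mem (Metric.ball_subset_closedBall hx)]
  have hinj : InjOn f (Metric.ball 0 R) := fun x hx y hy hxy =>
    hbij.1 (by simpa only [hfeq x hx, hfeq y hy] using hxy)
  have himage : f '' Metric.ball 0 R = Metric.ball 0 R := by
    apply Subset.antisymm
    · rintro _ ⟨x, hx, rfl⟩
      rw [mem_ball_zero_iff] at hx ⊢
      have : f x = (1 - t) • x + t • r x := by simp only [hf]; module
      rw [this]
      calc ‖(1 - t) • x + t • r x‖ ≤ (1 - t) * ‖x‖ + t * ‖r x‖ := by
            refine (norm_add_le _ _).trans_eq ?_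
            rw [norm_smul, norm_smul, Real.norm_of_nonneg ht0,
              Real.norm_of_nonneg (sub_nonneg.2 ht1.le)]
        _ < R := by nlinarith [h1 x hx.le]
    · intro y hy
      obtain ⟨x, hx⟩ := hbij.2 y
      have hxR : x ∈ Metric.ball (0 : E) R := by
        by_contra hxR
        have hz : (Metric.closedBall (0 : E) R).indicator (fun x => r x - x) x = 0 := by
          by_cases hxc : x ∈ Metric.closedBall (0 : E) R
          · rw [indicator_of_mem hxc, h2 x, sub_self]
            rw [mem_closedBall_zero_iff] at hxc
            rw [mem_ball_zero_iff, not_lt] at hxR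
            exact le_antisymm hxc hxR
          · exact indicator_of_notMem hxc _
        simp only [hz, smul_zero, add_zero] at hx
        exact hxR (hx ▸ hy)
      exact ⟨x, hxR, by rw [← hfeq x hxR]; exact hx⟩
  have hcv := integral_image_eq_integral_abs_det_fderiv_smul (volume : Measure E)
    (f := f) (f' := fun x => ContinuousLinearMap.id ℝ E + t • D x)
    (measurableSet_ball (x := (0 : E)) (ε := R))
    (fun x _ => ((hasFDerivAt_id x).add ((hgd x).const_smul t)).hasFDerivWithinAt) hinj
    (fun _ => (1 : ℝ))
  rw [himage] at hcv
  have hpos : ∀ x ∈ Metric.ball (0 : E) R,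
      |(ContinuousLinearMap.id ℝ E + t • D x).det| • (1 : ℝ)
        = (ContinuousLinearMap.id ℝ E + t • D x).det := by
    intro x hx
    rw [smul_eq_mul, mul_one, abs_of_pos]
    apply hdet
    rw [dist_zero_right, norm_smul, Real.norm_of_nonneg ht0]
    calc t * ‖D x‖ ≤ t * C :=
          mul_le_mul_of_nonneg_left (hC x (Metric.ball_subset_closedBall hx)) ht0
      _ < δ := (lt_div_iff₀ hC0).1 htδ
  rw [setIntegral_congr_fun measurableSet_ball hpos] at hcv
  rw [← hcv]
  simp

open MeasureTheory in
/-- There is no `C¹` retraction of a ball onto its boundary sphere. -/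
theorem not_exists_contDiff_retraction {r : E → E} (hr : ContDiff ℝ 1 r) {R : ℝ} (hR : 0 < R)
    (h1 : ∀ x, ‖x‖ ≤ R → ‖r x‖ = R) (h2 : ∀ x, ‖x‖ = R → r x = x) : False := by
  borelize E
  obtain ⟨ε, hε, hvol⟩ :=
    exists_forall_integral_det_eq_volume hr (fun x hx => (h1 x hx).le) h2
  set J : ℝ → E → ℝ := fun t x =>
    (ContinuousLinearMap.id ℝ E + t • (fderiv ℝ r x - ContinuousLinearMap.id ℝ E)).det with hJ
  have hJc : ∀ t, Continuous (J t) := fun t =>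
    ContinuousLinearMap.continuous_det.comp (continuous_const.add
      (((hr.continuous_fderiv one_ne_zero).sub continuous_const).const_smul t))
  have hJi : ∀ t, IntegrableOn (J t) (Metric.ball 0 R) := fun t =>
    ((hJc t).continuousOn.integrableOn_compact (isCompact_closedBall (0 : E) R)).mono_set
      Metric.ball_subset_closedBall
  set k := Module.finrank ℝ E + 1 with hk
  set v : ℕ → ℝ := fun i => ε / (i + 2) with hv
  have hv0 : ∀ i, 0 ≤ v i := fun i => by positivity
  have hvε : ∀ i, v i < ε := fun i => div_lt_self hε (by linarith [(Nat.cast_nonneg i : (0 : ℝ) ≤ i)])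
  have hvinj : Function.Injective v := by
    intro i j hij
    have hi : (0 : ℝ) < i + 2 := by positivity
    have hj : (0 : ℝ) < j + 2 := by positivity
    simp only [hv] at hij
    field_simp at hij
    exact_mod_cast (add_right_cancel hij).symm
  have hinterp : ∀ x, J 1 x = ∑ i ∈ Finset.range k,
      J (v i) x * (Lagrange.basis (Finset.range k) v i).eval 1 := by
    intro x
    obtain ⟨p, hp, hpe⟩ := exists_polynomial_eval_eq_det_id_add_smul
      (fderiv ℝ r x - ContinuousLinearMap.id ℝ E)
    simp only [hJ, ← hpe]
    exact eq_sum_lagrange_basis_eval hvinj (Nat.lt_succ_of_le hp) 1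
  have hI1 : ∫ x in Metric.ball (0 : E) R, J 1 x = volume.real (Metric.ball (0 : E) R) := by
    simp_rw [hinterp]
    rw [integral_finsetSum _ fun i _ => (hJi (v i)).mul_const _]
    simp_rw [integral_mul_const]
    rw [Finset.sum_congr rfl fun i _ => by rw [hvol (v i) (hv0 i) (hvε i)], ← Finset.mul_sum,
      ← Polynomial.eval_finsetSum, Lagrange.sum_basis hvinj.injOn ⟨0, by simp [hk]⟩,
      Polynomial.eval_one, mul_one]
  have hI0 : ∫ x in Metric.ball (0 : E) R, J 1 x = 0 := by
    refine setIntegral_eq_zero_of_forall_eq_zero fun x hx => ?_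
    simp only [hJ, one_smul, add_sub_cancel]
    refine det_fderiv_eq_zero_of_eventually_norm_eq (hr.differentiable one_ne_zero x) hR ?_
    filter_upwards [Metric.isOpen_ball.mem_nhds hx] with y hy
    exact h1 y (mem_ball_zero_iff.1 hy).le
  have hpos : 0 < volume.real (Metric.ball (0 : E) R) :=
    ENNReal.toReal_pos (Metric.measure_ball_pos _ _ hR).ne' measure_ball_lt_top.ne
  linarith

/-- **Brouwer's fixed-point theorem**, for bounded continuous maps on a Euclidean space. -/
theorem exists_fixedPoint_of_continuous_of_norm_le {G : E → E} (hG : Continuous G) {M : ℝ}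
    (hM : ∀ x, ‖G x‖ ≤ M) : ∃ x, G x = x := by
  by_contra! hne
  have hM0 : 0 ≤ M := (norm_nonneg _).trans (hM 0)
  let χ : ContDiffBump (0 : E) := ⟨M + 1, M + 2, by positivity, by linarith⟩
  set H : E → E := fun x => χ x • G x with hH
  have hHc : Continuous H := χ.continuous.smul hG
  have hH0 : ∀ x, M + 2 ≤ ‖x‖ → H x = 0 := fun x hx => by
    rw [hH]
    simp [χ.zero_of_le_dist (x := x) (by simpa using hx)]
  have hHne : ∀ x, H x ≠ x := by
    intro x hx
    have hle : ‖x‖ ≤ M := by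
      rw [← hx, hH]
      simp only [norm_smul, Real.norm_of_nonneg χ.nonneg]
      exact (mul_le_of_le_one_left (norm_nonneg _) χ.le_one).trans (hM x)
    refine hne x ?_
    rw [hH] at hx
    have hmem : x ∈ Metric.closedBall (0 : E) (M + 1) :=
      mem_closedBall_zero_iff.2 (by linarith)
    simpa [χ.one_of_mem_closedBall hmem] using hx
  obtain ⟨h, hh, happ, hsupp⟩ := hHc.exists_contDiff_approx 1 (ε := fun x => ‖x - H x‖)
    (continuous_id.sub hHc).norm fun x => norm_pos_iff.2 (sub_ne_zero.2 (hHne x).symm)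
  have hh0 : ∀ x, M + 2 ≤ ‖x‖ → h x = 0 := fun x hx => by
    by_contra hx'
    exact hsupp hx' (hH0 x hx)
  have hF : ∀ x, x - h x ≠ 0 := by
    intro x hx
    have := happ x
    rw [← sub_eq_zero.1 hx, dist_eq_norm] at this
    exact lt_irrefl _ this
  have hFc : ContDiff ℝ 1 fun x => x - h x := contDiff_id.sub hh
  refine not_exists_contDiff_retraction (R := M + 2)
    (r := fun x => ((M + 2) * ‖x - h x‖⁻¹) • (x - h x)) ?_ (by linarith) ?_ ?_
  · exact (contDiff_const.mul ((hFc.norm ℝ hF).inv fun x => norm_ne_zero_iff.2 (hF x))).smul hFc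
  · intro x _
    have := norm_pos_iff.2 (hF x)
    rw [norm_smul, Real.norm_of_nonneg (by positivity), mul_assoc, inv_mul_cancel₀ this.ne',
      mul_one]
  · intro x hx
    have hM2 : M + 2 ≠ 0 := by positivity
    simp [hh0 x hx.ge, hx, hM2]

end Brouwer

section Schauder

variable {X : Type*} [NormedAddCommGroup X] [NormedSpace ℝ X]

/-- A continuous self-map of a convex set with relatively compact range has approximate fixed
points. -/
theorem exists_norm_sub_le_of_mapsTo_isCompact {S K : Set X} (hS : Convex ℝ S) (hne : S.Nonempty)
    (hK : IsCompact K) (hKS : K ⊆ S) {T : X → X} (hT : ContinuousOn T S) (hTK : MapsTo T S K)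
    {ε : ℝ} (hε : 0 < ε) : ∃ x ∈ S, ‖T x - x‖ ≤ ε := by
  obtain ⟨t, htK, htf, hcover⟩ := hK.finite_cover_balls hε
  have := htf.fintype
  have htne : Nonempty t := by
    obtain ⟨x, hx⟩ := hne
    obtain ⟨y, hy, -⟩ := mem_iUnion₂.1 (hcover (hTK hx))
    exact ⟨⟨y, hy⟩⟩
  let s : EuclideanSpace ℝ t → ℝ := fun l => ∑ i, max (l i) 0
  let ρ : EuclideanSpace ℝ t → t → ℝ := fun l i => max (l i) 0 + max (1 - s l) 0
  have hρ0 : ∀ l i, 0 ≤ ρ l i := fun l i => by positivity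
  have hs0 : ∀ l, 0 ≤ s l := fun l => Finset.sum_nonneg fun i _ => le_max_right _ _
  have hρpos : ∀ l, 0 < ∑ i, ρ l i := by
    intro l
    rcases lt_or_ge (s l) 1 with h | h
    · exact Finset.sum_pos (fun i _ => add_pos_of_nonneg_of_pos (le_max_right _ _)
        (lt_max_of_lt_left (by linarith))) Finset.univ_nonempty
    · exact lt_of_lt_of_le (by linarith)
        (Finset.sum_le_sum fun i _ => le_add_of_nonneg_right (le_max_right _ _))
  let p : EuclideanSpace ℝ t → X := fun l => Finset.univ.centerMass (ρ l) (fun i : t => (i : X))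
  have hpS : ∀ l, p l ∈ S := fun l =>
    hS.centerMass_mem (fun i _ => hρ0 l i) (hρpos l) fun i _ => hKS (htK i.2)
  have hρc : ∀ i, Continuous fun l => ρ l i := fun i => by fun_prop
  have hpc : Continuous p := by
    refine Continuous.smul ?_ ?_
    · exact (continuous_finsetSum _ fun i _ => hρc i).inv₀ fun l => (hρpos l).ne'
    · exact continuous_finsetSum _ fun i _ => (hρc i).smul continuous_const
  let w : EuclideanSpace ℝ t → t → ℝ := fun l i => max (ε - dist (T (p l)) i) 0
  have hw0 : ∀ l i, 0 ≤ w l i := fun l i => le_max_right _ _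
  have hwpos : ∀ l, 0 < ∑ i, w l i := by
    intro l
    obtain ⟨y, hy, hyd⟩ := mem_iUnion₂.1 (hcover (hTK (hpS l)))
    refine Finset.sum_pos' (fun i _ => hw0 l i) ⟨⟨y, hy⟩, Finset.mem_univ _, ?_⟩
    exact lt_max_of_lt_left (sub_pos.2 hyd)
  have hTp : Continuous fun l => T (p l) := hT.comp_continuous hpc hpS
  have hwc : ∀ i, Continuous fun l => w l i := fun i =>
    (continuous_const.sub (hTp.dist continuous_const)).max continuous_const
  let G : EuclideanSpace ℝ t → EuclideanSpace ℝ t := fun l => WithLp.toLp 2 fun i => w l i / ∑ j, w l j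
  have hGc : Continuous G := (PiLp.continuous_toLp 2 _).comp <| continuous_pi fun i =>
    (hwc i).div (continuous_finsetSum _ fun j _ => hwc j) fun l => (hwpos l).ne'
  have hG0 : ∀ l i, 0 ≤ G l i := fun l i => div_nonneg (hw0 l i) (hwpos l).le
  have hGsum : ∀ l, ∑ i, G l i = 1 := fun l => by
    simp only [G, ← Finset.sum_div]
    exact div_self (hwpos l).ne'
  have hGM : ∀ l, ‖G l‖ ≤ √(Fintype.card t) := by
    intro l
    rw [EuclideanSpace.norm_eq]
    refine Real.sqrt_le_sqrt ?_
    refine (Finset.sum_le_card_nsmul _ _ 1 fun i _ => ?_).trans (by simp)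
    have h1 : G l i ≤ 1 :=
      (Finset.single_le_sum (fun j _ => hG0 l j) (Finset.mem_univ i)).trans_eq (hGsum l)
    rw [Real.norm_of_nonneg (hG0 l i)]
    exact pow_le_one₀ (hG0 l i) h1
  obtain ⟨l, hl⟩ := exists_fixedPoint_of_continuous_of_norm_le hGc hGM
  have hl0 : ∀ i, 0 ≤ l i := fun i => hl ▸ hG0 l i
  have hl1 : ∑ i, l i = 1 := by
    have := hGsum l
    rwa [hl] at this
  have hρl : ρ l = fun i => l i := by
    have hs : s l = 1 := by
      rw [← hl1]
      exact Finset.sum_congr rfl fun i _ => max_eq_left (hl0 i)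
    funext i
    simp [ρ, hs, hl0 i]
  have hpl : p l = ∑ i, l i • (i : X) := by
    simp only [p, hρl]
    exact Finset.centerMass_eq_of_sum_1 _ _ hl1
  refine ⟨p l, hpS l, ?_⟩
  have hsub : T (p l) - p l = ∑ i : t, l i • (T (p l) - i) := by
    simp only [smul_sub, Finset.sum_sub_distrib, ← Finset.sum_smul, hl1, one_smul, ← hpl]
  rw [hsub]
  calc ‖∑ i : t, l i • (T (p l) - i)‖ ≤ ∑ i : t, l i * ε := by
        refine norm_sum_le_of_le _ fun i _ => ?_
        rw [norm_smul, Real.norm_of_nonneg (hl0 i), ← dist_eq_norm]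
        rcases le_or_gt (dist (T (p l)) i) ε with h | h
        · exact mul_le_mul_of_nonneg_left h (hl0 i)
        · have hw : w l i = 0 := max_eq_right (by linarith)
          have : l i = 0 := by
            rw [← hl]
            simp [G, hw]
          simp [this]
    _ = ε := by rw [← Finset.sum_mul, hl1, one_mul]

/-- **Schauder's fixed-point theorem**: a continuous self-map of a nonempty convex set whose range
lies in a compact subset has a fixed point. -/
theorem exists_fixedPoint_of_mapsTo_isCompact {S K : Set X} (hS : Convex ℝ S) (hne : S.Nonempty)
    (hK : IsCompact K) (hKS : K ⊆ S) {T : X → X} (hT : ContinuousOn T S) (hTK : MapsTo T S K) :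
    ∃ x ∈ S, T x = x := by
  choose x hxS hx using fun n : ℕ => exists_norm_sub_le_of_mapsTo_isCompact hS hne hK hKS hT hTK
    (Nat.one_div_pos_of_nat (α := ℝ) (n := n))
  obtain ⟨z, hzK, ψ, hψ, hz⟩ := hK.tendsto_subseq fun n => hTK (hxS n)
  have h0 : Tendsto (fun n => T (x n) - x n) atTop (𝓝 0) :=
    squeeze_zero_norm hx tendsto_one_div_add_atTop_nhds_zero_nat
  have hxz : Tendsto (x ∘ ψ) atTop (𝓝 z) := by
    have := hz.sub (h0.comp hψ.tendsto_atTop)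
    simpa [Function.comp_def] using this
  have hTz : Tendsto (fun n => T (x (ψ n))) atTop (𝓝 (T z)) :=
    (hT z (hKS hzK)).tendsto.comp
      (tendsto_nhdsWithin_iff.2 ⟨hxz, Eventually.of_forall fun n => hxS _⟩)
  exact ⟨z, hKS hzK, tendsto_nhds_unique hTz hz⟩

end Schauder

section DContraction

variable {φ : ℝ → ℝ}

theorem IsDFunction.nonneg (hφ : IsDFunction φ) {t : ℝ} (ht : 0 ≤ t) : 0 ≤ φ t := by
  rcases ht.eq_or_lt with rfl | h
  · exact hφ.2.2.1.ge
  · exact (hφ.2.2.2 t h).le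

theorem IsDFunction.le_self (hφ : IsDFunction φ) (hlt : ∀ t : ℝ, 0 < t → φ t < t) {t : ℝ}
    (ht : 0 ≤ t) : φ t ≤ t := by
  rcases ht.eq_or_lt with rfl | h
  · exact hφ.2.2.1.le
  · exact (hlt t h).le

theorem IsDFunction.iterate_nonneg (hφ : IsDFunction φ) {d : ℝ} (hd : 0 ≤ d) (n : ℕ) :
    0 ≤ φ^[n] d := by
  induction n with
  | zero => exact hd
  | succ n ih =>
    rw [Function.iterate_succ_apply']
    exact hφ.nonneg ih

theorem IsDFunction.tendsto_iterate_zero (hφ : IsDFunction φ) (hlt : ∀ t : ℝ, 0 < t → φ t < t)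
    {d : ℝ} (hd : 0 ≤ d) : Tendsto (fun n => φ^[n] d) atTop (𝓝 0) := by
  have h0 := hφ.iterate_nonneg hd
  have hanti : Antitone fun n => φ^[n] d := antitone_nat_of_succ_le fun n => by
    rw [Function.iterate_succ_apply']
    exact hφ.le_self hlt (h0 n)
  have hL := tendsto_atTop_ciInf hanti ⟨0, by rintro _ ⟨n, rfl⟩; exact h0 n⟩
  set L := ⨅ n, φ^[n] d
  have hL0 : 0 ≤ L := ge_of_tendsto' hL h0
  have h1 : Tendsto (fun n => φ (φ^[n] d)) atTop (𝓝 (φ L)) :=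
    (hφ.1 L hL0).tendsto.comp (tendsto_nhdsWithin_iff.2 ⟨hL, Eventually.of_forall h0⟩)
  have h2 : Tendsto (fun n => φ (φ^[n] d)) atTop (𝓝 L) := by
    simpa only [Function.comp_def, Function.iterate_succ_apply'] using
      hL.comp (tendsto_add_atTop_nat 1)
  have h3 : φ L = L := tendsto_nhds_unique h1 h2
  have h4 : L = 0 := by
    by_contra hne
    exact (hlt L (lt_of_le_of_ne hL0 (Ne.symm hne))).ne h3
  rwa [h4] at hL

variable {X : Type*} [NormedAddCommGroup X]

/-- A nonlinear D-contraction of a nonempty bounded closed set into itself has a fixed point. -/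
theorem IsDFunction.exists_fixedPoint [CompleteSpace X] (hφ : IsDFunction φ)
    (hlt : ∀ t : ℝ, 0 < t → φ t < t)
    {S : Set X} (hne : S.Nonempty) (hcl : IsClosed S) (hbd : Bornology.IsBounded S) {T : X → X}
    (hTS : MapsTo T S S) (hT : ∀ u ∈ S, ∀ v ∈ S, ‖T u - T v‖ ≤ φ ‖u - v‖) :
    ∃ x ∈ S, T x = x := by
  obtain ⟨x, hx⟩ := hne
  have hit : ∀ n, ∀ u ∈ S, ∀ v ∈ S, ‖T^[n] u - T^[n] v‖ ≤ φ^[n] (Metric.diam S) := by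
    intro n u hu v hv
    induction n with
    | zero => simpa [dist_eq_norm] using Metric.dist_le_diam_of_mem hbd hu hv
    | succ n ih =>
      simp only [Function.iterate_succ_apply']
      exact (hT _ (hTS.iterate n hu) _ (hTS.iterate n hv)).trans
        (hφ.2.1 (norm_nonneg _) (hφ.iterate_nonneg Metric.diam_nonneg n) ih)
  have hcau : CauchySeq fun n => T^[n] x := by
    refine cauchySeq_of_le_tendsto_0 (fun N => φ^[N] (Metric.diam S)) (fun n m N hn hm => ?_)
      (hφ.tendsto_iterate_zero hlt Metric.diam_nonneg)
    obtain ⟨a, rfl⟩ := Nat.exists_eq_add_of_le hn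
    obtain ⟨b, rfl⟩ := Nat.exists_eq_add_of_le hm
    rw [Function.iterate_add_apply, Function.iterate_add_apply, dist_eq_norm]
    exact hit N _ (hTS.iterate a hx) _ (hTS.iterate b hx)
  obtain ⟨z, hz⟩ := cauchySeq_tendsto_of_complete hcau
  have hzS : z ∈ S := hcl.mem_of_tendsto hz (Eventually.of_forall fun n => hTS.iterate n hx)
  have hTz : Tendsto (fun n => T (T^[n] x)) atTop (𝓝 (T z)) := by
    rw [tendsto_iff_norm_sub_tendsto_zero] at hz ⊢
    exact squeeze_zero (fun _ => norm_nonneg _) (fun n =>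
      (hT _ (hTS.iterate n hx) _ hzS).trans (hφ.le_self hlt (norm_nonneg _))) hz
  have hz' : Tendsto (fun n => T (T^[n] x)) atTop (𝓝 z) := by
    simpa only [Function.comp_def, Function.iterate_succ_apply'] using
      hz.comp (tendsto_add_atTop_nat 1)
  exact ⟨z, hzS, tendsto_nhds_unique hTz hz'⟩

/-- On a bounded range, `t` is small as soon as `t - φ t` is small. -/
theorem IsDFunction.exists_forall_lt_of_sub_lt (hφ : IsDFunction φ)
    (hlt : ∀ t : ℝ, 0 < t → φ t < t) (d : ℝ) {ε : ℝ} (hε : 0 < ε) :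
    ∃ δ > 0, ∀ t ≤ d, t - φ t < δ → t < ε := by
  have hc : ContinuousOn (fun t => t - φ t) (Icc ε (max d ε)) :=
    continuousOn_id.sub (hφ.1.mono fun t ht => hε.le.trans ht.1)
  obtain ⟨t₀, ht₀, hmin⟩ := isCompact_Icc.exists_isMinOn ⟨ε, le_rfl, le_max_right _ _⟩ hc
  refine ⟨t₀ - φ t₀, sub_pos.2 (hlt t₀ (hε.trans_le ht₀.1)), fun t htd ht => ?_⟩
  by_contra! hεt
  exact (hmin ⟨hεt, htd.trans (le_max_left _ _)⟩).not_gt ht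

end DContraction

/-- extension of Krasnoselskii's fixed-point theorem
(Theorem 3.1 / `[NW, Theorem 1]`). -/
theorem krasnoselskii_D_contraction
    {X : Type*} [NormedAddCommGroup X] [NormedSpace ℝ X] [CompleteSpace X]
    (S : Set X) (hne : S.Nonempty) (hcl : IsClosed S) (hcv : Convex ℝ S)
    (hbd : Bornology.IsBounded S)
    (A B : X → X) (φ : ℝ → ℝ)
    (hφD : IsDFunction φ) (hφlt : ∀ t : ℝ, 0 < t → φ t < t)
    (hA : ∀ u ∈ S, ∀ v ∈ S, ‖A u - A v‖ ≤ φ ‖u - v‖)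
    (hBc : ContinuousOn B S)
    (hBk : IsCompact (closure (B '' S)))
    (hAB : ∀ u ∈ S, ∀ v ∈ S, A u + B v ∈ S) :
    ∃ u ∈ S, A u + B u = u := by
  set K := closure (B '' S)
  have hAK : ∀ y ∈ K, ∀ u ∈ S, A u + y ∈ S := by
    intro y hy u hu
    have hsub : B '' S ⊆ (fun y => A u + y) ⁻¹' S := by
      rintro _ ⟨v, hv, rfl⟩
      exact hAB u hu v hv
    exact closure_minimal hsub (hcl.preimage (continuous_const.add continuous_id)) hy
  have hfix : ∀ y ∈ K, ∃ x ∈ S, A x + y = x := fun y hy =>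
    hφD.exists_fixedPoint hφlt hne hcl hbd (T := fun u => A u + y) (fun u hu => hAK y hy u hu)
      fun u hu v hv => by simpa using hA u hu v hv
  choose! R hRS hR using hfix
  have hRc : ContinuousOn R K := by
    rw [Metric.continuousOn_iff]
    intro y hy ε hε
    obtain ⟨δ, hδ, hδε⟩ := hφD.exists_forall_lt_of_sub_lt hφlt (Metric.diam S) hε
    refine ⟨δ, hδ, fun y' hy' hd => ?_⟩
    refine hδε _ (Metric.dist_le_diam_of_mem hbd (hRS y' hy') (hRS y hy)) (lt_of_le_of_lt ?_ hd)
    have h1 : R y' - R y = (A (R y') - A (R y)) + (y' - y) := by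
      nth_rewrite 1 [← hR y' hy', ← hR y hy]
      abel
    have h2 := norm_add_le (A (R y') - A (R y)) (y' - y)
    rw [← h1] at h2
    rw [dist_eq_norm, dist_eq_norm]
    linarith [hA _ (hRS y' hy') _ (hRS y hy)]
  have hBK : MapsTo B S K := fun u hu => subset_closure (mem_image_of_mem B hu)
  obtain ⟨u, hu, hfu⟩ := exists_fixedPoint_of_mapsTo_isCompact hcv hne
    (hBk.image_of_continuousOn hRc) (image_subset_iff.2 hRS) (hRc.comp hBc hBK) fun u hu => mem_image_of_mem R (hBK hu)
  refine ⟨u, hu, ?_⟩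
  have := hR (B u) (hBK hu)
  rwa [show R (B u) = u from hfu] at this

end HMDEPaper
end

section
/- Let J = [t₀, t₀ + a] with a > 0, let x ∈ G(J, ℝⁿ), and let f : J × ℝⁿ → ℝⁿ be a function such that: (i) for each v in the closure of the range {x(t) : t ∈ J}, the function t ↦ f(t, v) is regulated on J; (ii) for each s ∈ J the function y(s) : J → ℝⁿ, y(s)(t) = f(s, x(t)), is regulated, and the family {y(s) : s ∈ J} is equiregulated. Then the function z : J → ℝⁿ given by z(t) = f(t, x(t)) is regulated on J. -/
open Set Filter Topology

namespace HMDEPaper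

/-- A function that is, for every `ε`, eventually within `ε` of some function convergent along `l`
converges along `l`. -/
theorem exists_tendsto_of_forall_eventually_norm_sub_lt {α E : Type*} [NormedAddCommGroup E]
    [CompleteSpace E] {l : Filter α} {z : α → E}
    (h : ∀ ε : ℝ, 0 < ε → ∃ g : α → E, (∃ L, Tendsto g l (𝓝 L)) ∧ ∀ᶠ t in l, ‖z t - g t‖ < ε) :
    ∃ L, Tendsto z l (𝓝 L) := by
  rcases l.eq_or_neBot with rfl | hl
  · exact ⟨0, tendsto_bot⟩
  · refine cauchy_map_iff_exists_tendsto.1 (Metric.cauchy_iff.2 ⟨inferInstance, fun ε hε => ?_⟩)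
    obtain ⟨g, ⟨L, hL⟩, hg⟩ := h (ε / 4) (by positivity)
    have hgL := Metric.tendsto_nhds.1 hL (ε / 4) (by positivity)
    have hz : ∀ᶠ t in l, z t ∈ Metric.ball L (ε / 2) := by
      filter_upwards [hg, hgL] with t hzg hgt
      rw [← dist_eq_norm] at hzg
      rw [Metric.mem_ball]
      linarith [dist_triangle (z t) (g t) L]
    refine ⟨Metric.ball L (ε / 2), hz, fun u hu v hv => ?_⟩
    rw [Metric.mem_ball] at hu hv
    linarith [dist_triangle_right u v L]

/-- Theorem 3.1 of the paper: if `f(·,v)` is regulated for each `v` in the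
closure of the range of `x`, each `t ↦ f(s, x(t))` is regulated, and the family
`{t ↦ f(s, x(t)) : s ∈ J}` is equiregulated, then `t ↦ f(t, x(t))` is regulated. -/
theorem regulated_composition_of_equiregulated
    {n : ℕ} (t₀ a : ℝ) (ha : 0 < a)
    (x : ℝ → En n) (hx : RegulatedOn x t₀ (t₀ + a))
    (f : ℝ → En n → En n)
    (h1 : ∀ v ∈ closure (x '' Set.Icc t₀ (t₀ + a)),
      RegulatedOn (fun t => f t v) t₀ (t₀ + a))
    (h2 : ∀ s ∈ Set.Icc t₀ (t₀ + a), RegulatedOn (fun t => f s (x t)) t₀ (t₀ + a))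
    (h3 : EquiregulatedOn {y : ℝ → En n | ∃ s ∈ Set.Icc t₀ (t₀ + a),
      y = fun t => f s (x t)} t₀ (t₀ + a)) :
    RegulatedOn (fun t => f t (x t)) t₀ (t₀ + a) := by
  have close {u v L : En n} {ε : ℝ} (hu : ‖u - L‖ < ε / 2) (hv : ‖v - L‖ < ε / 2) :
      ‖u - v‖ < ε := by
    rw [← dist_eq_norm] at *
    linarith [dist_triangle_right u v L]
  refine ⟨fun τ hτ => exists_tendsto_of_forall_eventually_norm_sub_lt fun ε hε => ?_,
    fun τ hτ => exists_tendsto_of_forall_eventually_norm_sub_lt fun ε hε => ?_⟩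
  · obtain ⟨δ, hδ, hy⟩ := (h3 (ε / 2) (by positivity)).1 τ hτ
    obtain ⟨r, hr, hrτ⟩ := exists_between (max_lt hτ.1 (sub_lt_self τ hδ))
    rw [max_lt_iff] at hr
    refine ⟨fun t => f t (x r), (h1 _ (subset_closure ⟨r, ⟨hr.1.le, hrτ.le.trans hτ.2⟩, rfl⟩)).1
      τ hτ, ?_⟩
    filter_upwards [self_mem_nhdsWithin,
      mem_nhdsWithin_of_mem_nhds (Ioi_mem_nhds (sub_lt_self τ hδ))] with t ht htδ
    have htJ : t ∈ Set.Icc t₀ (t₀ + a) := ⟨ht.1, ht.2.le.trans hτ.2⟩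
    obtain ⟨L, hL⟩ := (h2 t htJ).1 τ hτ
    have hyt := hy _ ⟨t, htJ, rfl⟩ L hL
    exact close (hyt t ht htδ) (hyt r ⟨hr.1.le, hrτ⟩ hr.2)
  · obtain ⟨δ, hδ, hy⟩ := (h3 (ε / 2) (by positivity)).2 τ hτ
    obtain ⟨r, hτr, hr⟩ := exists_between (lt_min hτ.2 (lt_add_of_pos_right τ hδ))
    rw [lt_min_iff] at hr
    refine ⟨fun t => f t (x r), (h1 _ (subset_closure ⟨r, ⟨hτ.1.trans hτr.le, hr.1.le⟩, rfl⟩)).2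
      τ hτ, ?_⟩
    filter_upwards [self_mem_nhdsWithin,
      mem_nhdsWithin_of_mem_nhds (Iio_mem_nhds (lt_add_of_pos_right τ hδ))] with t ht htδ
    have htJ : t ∈ Set.Icc t₀ (t₀ + a) := ⟨hτ.1.trans ht.1.le, ht.2⟩
    obtain ⟨L, hL⟩ := (h2 t htJ).2 τ hτ
    have hyt := hy _ ⟨t, htJ, rfl⟩ L hL
    exact close (hyt t ht htδ) (hyt r ⟨hτr, hr.1.le⟩ hr.2)

end HMDEPaper
end

section
/- Let J = [t₀, t₀ + a] with a > 0, let x ∈ G(J, ℝⁿ), and let f : J × ℝⁿ → ℝⁿ satisfy: (a) for every v in the closure of the range {x(t) : t ∈ J}, the function t ↦ f(t, v) is regulated on J; (b) the functions f(t, ·) are continuous uniformly for t ∈ J, i.e., for every ε > 0 there is δ > 0 such that ‖f(t, u) − f(t, v)‖ < ε for all t ∈ J and all u, v ∈ ℝⁿ with ‖u − v‖ < δ. Then the function z : J → ℝⁿ given by z(t) = f(t, x(t)) is regulated on J. -/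
open Set Filter Topology

namespace HMDEPaper

/-- If `x` tends to `L` and `t ↦ f t L` tends to `M` along `l`, and the functions `f t` are
uniformly continuous, uniformly in `t ∈ s`, where `s ∈ l`, then `t ↦ f t (x t)` tends to `M`. -/
theorem tendsto_comp_of_uniform_continuity {α E F : Type*} [SeminormedAddCommGroup E]
    [SeminormedAddCommGroup F] {l : Filter α} {s : Set α} (hs : s ∈ l)
    {x : α → E} {L : E} (hx : Tendsto x l (𝓝 L)) {f : α → E → F} {M : F}
    (hM : Tendsto (fun t => f t L) l (𝓝 M))
    (hf : ∀ ε : ℝ, 0 < ε → ∃ δ > (0 : ℝ), ∀ t ∈ s,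
      ∀ u v : E, ‖u - v‖ < δ → ‖f t u - f t v‖ < ε) :
    Tendsto (fun t => f t (x t)) l (𝓝 M) := by
  have h : Tendsto (fun t => f t (x t) - f t L) l (𝓝 0) := by
    rw [Metric.tendsto_nhds]
    intro ε hε
    obtain ⟨δ, hδ, hfδ⟩ := hf ε hε
    filter_upwards [hs, Metric.tendsto_nhds.1 hx δ hδ] with t ht hxt
    rw [dist_zero_right]
    exact hfδ t ht _ _ (by rwa [← dist_eq_norm])
  simpa using h.add hM

/-- Corollary 3.1: if `f(·,v)` is regulated for each `v` in the closure of the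
range of `x`, and the functions `f(t,·)` are continuous uniformly in `t ∈ J`, then
`t ↦ f(t, x(t))` is regulated. -/
theorem regulated_composition_of_uniform_continuity
    {n : ℕ} (t₀ a : ℝ) (ha : 0 < a)
    (x : ℝ → En n) (hx : RegulatedOn x t₀ (t₀ + a))
    (f : ℝ → En n → En n)
    (h1 : ∀ v ∈ closure (x '' Set.Icc t₀ (t₀ + a)),
      RegulatedOn (fun t => f t v) t₀ (t₀ + a))
    (h2 : ∀ ε : ℝ, 0 < ε → ∃ δ > (0 : ℝ), ∀ t ∈ Set.Icc t₀ (t₀ + a),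
      ∀ u v : En n, ‖u - v‖ < δ → ‖f t u - f t v‖ < ε) :
    RegulatedOn (fun t => f t (x t)) t₀ (t₀ + a) := by
  constructor
  · intro t ht
    obtain ⟨L, hL⟩ := hx.1 t ht
    have : (𝓝[Ico t₀ t] t).NeBot := by
      rw [nhdsWithin_Ico_eq_nhdsLT ht.1]
      infer_instance
    have hs : Icc t₀ (t₀ + a) ∈ 𝓝[Ico t₀ t] t :=
      mem_of_superset self_mem_nhdsWithin fun r hr => ⟨hr.1, hr.2.le.trans ht.2⟩
    obtain ⟨M, hM⟩ := (h1 L (mem_closure_of_tendsto hL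
      (mem_of_superset hs fun r hr => mem_image_of_mem x hr))).1 t ht
    exact ⟨M, tendsto_comp_of_uniform_continuity hs hL hM h2⟩
  · intro t ht
    obtain ⟨L, hL⟩ := hx.2 t ht
    have : (𝓝[Ioc t (t₀ + a)] t).NeBot := by
      rw [nhdsWithin_Ioc_eq_nhdsGT ht.2]
      infer_instance
    have hs : Icc t₀ (t₀ + a) ∈ 𝓝[Ioc t (t₀ + a)] t :=
      mem_of_superset self_mem_nhdsWithin fun r hr => ⟨ht.1.trans hr.1.le, hr.2⟩
    obtain ⟨M, hM⟩ := (h1 L (mem_closure_of_tendsto hL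
      (mem_of_superset hs fun r hr => mem_image_of_mem x hr))).2 t ht
    exact ⟨M, tendsto_comp_of_uniform_continuity hs hL hM h2⟩

end HMDEPaper
end

section
/- Let g : [a,b] → ℝ be a nondecreasing left-continuous function, let η : [a,b] → ℝ be a bounded function that is Kurzweil–Stieltjes integrable with respect to g on [a,b], and let u : [a,b] → ℝ be a regulated function. Then the product function t ↦ u(t)η(t) is Kurzweil–Stieltjes integrable with respect to g on [a,b]. -/
open Set Filter Topology

namespace HMDEPaper

/-- `IsRiemannSum g δ c d S`: the functional `S` sends `f` to the Riemann sum of `f` with respect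
to `g` over some `δ`-fine (possibly empty) tagged partition of `[c, d]`. -/
inductive IsRiemannSum (g δ : ℝ → ℝ) (c : ℝ) : ℝ → ((ℝ → ℝ) → ℝ) → Prop
  | nil : IsRiemannSum g δ c c (fun _ => 0)
  | snoc {m d τ : ℝ} {S : (ℝ → ℝ) → ℝ} (hS : IsRiemannSum g δ c m S) (hτ : τ ∈ Icc m d)
      (hfine : Icc m d ⊆ Ioo (τ - δ τ) (τ + δ τ)) :
      IsRiemannSum g δ c d (fun f => S f + (g d - g m) * f τ)

namespace IsRiemannSum

variable {g δ δ' : ℝ → ℝ} {c m d : ℝ} {S S' : (ℝ → ℝ) → ℝ}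

lemma le (h : IsRiemannSum g δ c d S) : c ≤ d := by
  induction h with
  | nil => exact le_rfl
  | snoc _ hτ _ ih => exact ih.trans (hτ.1.trans hτ.2)

lemma mono (hδ : ∀ t, δ t ≤ δ' t) (h : IsRiemannSum g δ c d S) : IsRiemannSum g δ' c d S := by
  induction h with
  | nil => exact .nil
  | @snoc m d τ S _ hτ hfine ih =>
    exact ih.snoc hτ (hfine.trans (Ioo_subset_Ioo (by linarith [hδ τ]) (by linarith [hδ τ])))

lemma linear (h : IsRiemannSum g δ c d S) (α β : ℝ) (f₁ f₂ f₃ : ℝ → ℝ) :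
    S (fun t => α * f₁ t + β * f₂ t + f₃ t) = α * S f₁ + β * S f₂ + S f₃ := by
  induction h with
  | nil => simp
  | snoc _ _ _ ih => simp only [ih]; ring

lemma append (h : IsRiemannSum g δ c m S) (h' : IsRiemannSum g δ m d S') :
    IsRiemannSum g δ c d (fun f => S f + S' f) := by
  induction h' with
  | nil => simpa using h
  | snoc _ hτ hfine ih =>
    have := ih.snoc hτ hfine
    simpa only [add_assoc] using this

lemma split (h : IsRiemannSum g δ c d S) (hm : m ∈ Icc c d)
    (hδ : ∀ t, t ≠ m → δ t ≤ |t - m|) :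
    ∃ S₁ S₂, IsRiemannSum g δ c m S₁ ∧ IsRiemannSum g δ m d S₂ ∧ ∀ f, S f = S₁ f + S₂ f := by
  induction h with
  | nil =>
    obtain rfl : m = c := le_antisymm hm.2 hm.1
    exact ⟨_, _, .nil, .nil, by simp⟩
  | @snoc x d τ S hS hτ hfine ih =>
    rcases le_or_gt m x with hmx | hxm
    · obtain ⟨S₁, S₂, h₁, h₂, hS⟩ := ih ⟨hm.1, hmx⟩
      exact ⟨_, _, h₁, h₂.snoc hτ hfine, fun f => by simp only [hS]; ring⟩
    · have hmem := hfine ⟨hxm.le, hm.2⟩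
      obtain rfl : τ = m := by
        by_contra hne
        have h₁ := hδ τ hne
        have h₂ : |τ - m| < δ τ := abs_lt.2 ⟨by linarith [hmem.2], by linarith [hmem.1]⟩
        linarith
      exact ⟨_, _, hS.snoc ⟨hτ.1, le_rfl⟩ ((Icc_subset_Icc_right hτ.2).trans hfine),
        (nil (g := g) (δ := δ) (c := τ)).snoc ⟨le_rfl, hτ.2⟩
          ((Icc_subset_Icc_left hτ.1).trans hfine),
        fun f => by ring⟩

/-- Cousin's lemma. -/
lemma exists_of_le (g : ℝ → ℝ) (hδ : ∀ t, 0 < δ t) (hcd : c ≤ d) :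
    ∃ S, IsRiemannSum g δ c d S := by
  set A : Set ℝ := {x | x ≤ d ∧ ∃ S, IsRiemannSum g δ c x S} with hA
  have hcA : c ∈ A := ⟨hcd, _, .nil⟩
  have hbdd : BddAbove A := ⟨d, fun x hx => hx.1⟩
  have hσd : sSup A ≤ d := csSup_le ⟨c, hcA⟩ fun x hx => hx.1
  obtain ⟨y, hyA, hy⟩ := exists_lt_of_lt_csSup ⟨c, hcA⟩ (sub_lt_self (sSup A) (hδ (sSup A)))
  have hyσ := le_csSup hbdd hyA
  obtain ⟨-, S, hS⟩ := hyA
  have hpos := hδ (sSup A)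
  have hx : sSup A ≤ min d (sSup A + δ (sSup A) / 2) := le_min hσd (by linarith)
  have hx₂ := min_le_right d (sSup A + δ (sSup A) / 2)
  have hS' := hS.snoc (τ := sSup A) (d := min d (sSup A + δ (sSup A) / 2)) ⟨hyσ, hx⟩
    (fun z hz => ⟨by linarith [hz.1], by linarith [hz.2]⟩)
  have hle : min d (sSup A + δ (sSup A) / 2) ≤ sSup A :=
    le_csSup hbdd ⟨min_le_left _ _, _, hS'⟩
  rcases min_choice d (sSup A + δ (sSup A) / 2) with h | h
  · rw [h] at hS'
    exact ⟨_, hS'⟩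
  · rw [h] at hle
    linarith

lemma abs_le_mul_sub (h : IsRiemannSum g δ c d S) (hg : MonotoneOn g (Icc c d))
    {f : ℝ → ℝ} {M : ℝ} (hf : ∀ t ∈ Icc c d, |f t| ≤ M) : |S f| ≤ M * (g d - g c) := by
  induction h with
  | nil => simp
  | @snoc x d τ S hS hτ hfine ih =>
    have hcx := hS.le
    have hxd := hτ.1.trans hτ.2
    have h₁ := ih (hg.mono (Icc_subset_Icc_right hxd)) fun t ht => hf t ⟨ht.1, ht.2.trans hxd⟩
    have h₂ : 0 ≤ g d - g x := sub_nonneg.2 (hg ⟨hcx, hxd⟩ ⟨hcx.trans hxd, le_rfl⟩ hxd)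
    have h₃ : |(g d - g x) * f τ| ≤ M * (g d - g x) := by
      rw [abs_mul, abs_of_nonneg h₂, mul_comm]
      exact mul_le_mul_of_nonneg_right (hf τ ⟨hcx.trans hτ.1, hτ.2⟩) h₂
    calc |S f + (g d - g x) * f τ| ≤ |S f| + |(g d - g x) * f τ| := abs_add_le _ _
      _ ≤ M * (g d - g c) := by linarith

lemma nonneg (h : IsRiemannSum g δ c d S) (hg : MonotoneOn g (Icc c d))
    {f : ℝ → ℝ} (hf : ∀ t, 0 ≤ f t) : 0 ≤ S f := by
  induction h with
  | nil => exact le_rfl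
  | @snoc x d τ S hS hτ hfine ih =>
    have hcx := hS.le
    have hxd := hτ.1.trans hτ.2
    have h₁ := ih (hg.mono (Icc_subset_Icc_right hxd))
    have h₂ : 0 ≤ g d - g x := sub_nonneg.2 (hg ⟨hcx, hxd⟩ ⟨hcx.trans hxd, le_rfl⟩ hxd)
    have := mul_nonneg h₂ (hf τ)
    linarith

lemma apply_single_right_le {p : ℝ} (h : IsRiemannSum g δ c d S) (hg : MonotoneOn g (Icc c d))
    (hm : m ∈ Icc c p) (hdp : d ≤ p) (hδ : δ p ≤ p - m) :
    S (Pi.single p 1) ≤ max 0 (g d - g m) := by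
  induction h with
  | nil => exact le_max_left _ _
  | @snoc x d τ S hS hτ hfine ih =>
    have hcx := hS.le
    have hxd := hτ.1.trans hτ.2
    have h₁ := ih (hg.mono (Icc_subset_Icc_right hxd)) (hxd.trans hdp)
    have h₂ : g x ≤ g d := hg ⟨hcx, hxd⟩ ⟨hcx.trans hxd, le_rfl⟩ hxd
    rcases eq_or_ne τ p with rfl | hne
    · have hx := (hfine ⟨le_rfl, hxd⟩).1
      have hmx : m ≤ x := by linarith
      have h₃ : g m ≤ g x := hg ⟨hm.1, hmx.trans hxd⟩ ⟨hcx, hxd⟩ hmx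
      rw [max_eq_right (sub_nonneg.2 h₃)] at h₁
      refine le_max_of_le_right ?_
      simp only [Pi.single_eq_same]
      linarith
    · simp only [Pi.single_eq_of_ne hne, mul_zero, add_zero]
      exact h₁.trans (max_le_max le_rfl (by linarith))

lemma apply_single_left_le (h : IsRiemannSum g δ c d S) (hg : MonotoneOn g (Icc c d))
    (hgm : ∀ t ∈ Icc c d, t ≤ m → g t ≤ g m) (hm : g c ≤ g m) (hδ : δ c ≤ m - c) :
    S (Pi.single c 1) ≤ min (g d) (g m) - g c := by
  induction h with
  | nil => simp [hm]
  | @snoc x d τ S hS hτ hfine ih =>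
    have hcx := hS.le
    have hxd := hτ.1.trans hτ.2
    have h₁ := ih (hg.mono (Icc_subset_Icc_right hxd))
      fun t ht => hgm t ⟨ht.1, ht.2.trans hxd⟩
    have h₂ : g x ≤ g d := hg ⟨hcx, hxd⟩ ⟨hcx.trans hxd, le_rfl⟩ hxd
    rcases eq_or_ne τ c with rfl | hne
    · have hd := (hfine ⟨hxd, le_rfl⟩).2
      have hdm : g d ≤ g m := hgm d ⟨hcx.trans hxd, le_rfl⟩ (by linarith)
      have := min_le_left (g x) (g m)
      simp only [Pi.single_eq_same, min_eq_left hdm]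
      linarith
    · simp only [Pi.single_eq_of_ne hne, mul_zero, add_zero]
      exact h₁.trans (sub_le_sub_right (min_le_min h₂ le_rfl) _)

lemma le_apply_single_left {G : ℝ} (h : IsRiemannSum g δ c d S) (hg : MonotoneOn g (Icc c d))
    (hG : ∀ t ∈ Ioc c d, G ≤ g t) (hcd : c < d) (hδ : ∀ t, t ≠ c → δ t ≤ |t - c|) :
    G - g c ≤ S (Pi.single c 1) := by
  induction h with
  | nil => exact absurd hcd (lt_irrefl _)
  | @snoc x d τ S hS hτ hfine ih =>
    have hcx := hS.le
    have hxd := hτ.1.trans hτ.2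
    have hgx := hg.mono (Icc_subset_Icc_right hxd)
    have h₂ : g x ≤ g d := hg ⟨hcx, hxd⟩ ⟨hcx.trans hxd, le_rfl⟩ hxd
    have hsingle : ∀ t, (0 : ℝ) ≤ (Pi.single c 1 : ℝ → ℝ) t := fun t => by
      rcases eq_or_ne t c with rfl | hne <;> simp [*]
    rcases hcx.eq_or_lt with rfl | hlt
    · obtain rfl : τ = c := by
        by_contra hne
        have hmem := hfine ⟨le_rfl, hxd⟩
        have h₃ := hδ τ hne
        rw [abs_of_nonneg (sub_nonneg.2 hτ.1)] at h₃
        linarith [hmem.1]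
      have h₄ := hS.nonneg hgx hsingle
      have h₅ := hG d ⟨hcd, le_rfl⟩
      simp only [Pi.single_eq_same]
      linarith
    · have h₁ := ih hgx (fun t ht => hG t ⟨ht.1, ht.2.trans hxd⟩) hlt
      have := mul_nonneg (sub_nonneg.2 h₂) (hsingle τ)
      linarith

lemma of_taggedPartition {a b : ℝ} (P : TaggedPartition a b) (hP : P.IsFine δ) :
    IsRiemannSum g δ a b (fun f => P.sum f g) := by
  have key : ∀ i ≤ P.n, IsRiemannSum g δ a (P.s i)
      (fun f => ∑ j ∈ Finset.range i, (g (P.s (j + 1)) - g (P.s j)) • f (P.τ j)) := by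
    intro i
    induction i with
    | zero => intro _; simpa [P.s_first] using nil (g := g) (δ := δ) (c := a)
    | succ i ih =>
      intro hi
      simp only [Finset.sum_range_succ]
      exact (ih (by omega)).snoc (P.tag_mem i hi) (hP i hi)
  have := key P.n le_rfl
  rwa [P.s_last] at this

lemma exists_taggedPartition (hδ : ∀ t, 0 < δ t) (h : IsRiemannSum g δ c d S) :
    ∃ P : TaggedPartition c d, P.IsFine δ ∧ ∀ f, P.sum f g = S f := by
  induction h with
  | nil =>
    refine ⟨⟨1, one_pos, fun _ => c, fun _ => c, rfl, rfl, fun _ _ => le_rfl, fun _ _ => by simp⟩,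
      fun i _ => ?_, fun f => by simp [TaggedPartition.sum]⟩
    simp [hδ c]
  | @snoc x d τ S hS hτ hfine ih =>
    obtain ⟨P, hP, hsum⟩ := ih
    have hlast : ∀ i < P.n + 1, i < P.n ∨ i = P.n := fun i hi => by omega
    refine ⟨⟨P.n + 1, Nat.succ_pos _, fun i => if i ≤ P.n then P.s i else d,
      fun i => if i < P.n then P.τ i else τ, by simp [P.s_first], by simp, ?_, ?_⟩, ?_, ?_⟩
    · intro i hi
      rcases hlast i hi with h | rfl
      · simpa [h.le, Nat.succ_le_of_lt h] using P.s_mono i h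
      · simpa [P.s_last] using hτ.1.trans hτ.2
    · intro i hi
      rcases hlast i hi with h | rfl
      · simpa [h, h.le, Nat.succ_le_of_lt h] using P.tag_mem i h
      · simpa [P.s_last] using hτ
    · intro i hi
      rcases hlast i hi with h | rfl
      · simpa [h, h.le, Nat.succ_le_of_lt h] using hP i h
      · simpa [P.s_last] using hfine
    · intro f
      simp only [← hsum f, TaggedPartition.sum, Finset.sum_range_succ]
      congr 1
      · refine Finset.sum_congr rfl fun i hi => ?_
        have h := Finset.mem_range.1 hi
        simp [h, h.le, Nat.succ_le_of_lt h]
      · simp [P.s_last]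

end IsRiemannSum

/-- Any two sufficiently fine Riemann sums of `f` over `[c, d]` differ by at most
`κ * (g d - g c)`, up to an arbitrarily small error. For `κ = 0` this is the Cauchy criterion. -/
def AlmostKSCauchy (f g : ℝ → ℝ) (κ c d : ℝ) : Prop :=
  ∀ ε : ℝ, 0 < ε → ∃ δ : ℝ → ℝ, (∀ t, 0 < δ t) ∧ ∀ S S', IsRiemannSum g δ c d S →
    IsRiemannSum g δ c d S' → |S f - S' f| ≤ κ * (g d - g c) + ε

lemma KSIntegrable.almostKSCauchy {f g : ℝ → ℝ} {c d : ℝ} (h : KSIntegrable f g c d) :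
    AlmostKSCauchy f g 0 c d := by
  obtain ⟨I, hI⟩ := h
  intro ε hε
  obtain ⟨δ, hδ, hP⟩ := hI (ε / 2) (by positivity)
  refine ⟨δ, hδ, fun S S' hS hS' => ?_⟩
  obtain ⟨P, hPf, hPS⟩ := hS.exists_taggedPartition hδ
  obtain ⟨Q, hQf, hQS⟩ := hS'.exists_taggedPartition hδ
  have h₁ := abs_lt.1 (hP P hPf)
  have h₂ := abs_lt.1 (hP Q hQf)
  rw [hPS] at h₁
  rw [hQS] at h₂
  exact abs_le.2 ⟨by linarith, by linarith⟩

namespace AlmostKSCauchy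

variable {f g : ℝ → ℝ} {κ a b c m d : ℝ}

lemma ksIntegrable (hcd : c ≤ d) (h : AlmostKSCauchy f g 0 c d) : KSIntegrable f g c d := by
  let F : {δ : ℝ → ℝ // ∀ t, 0 < δ t} → Set ℝ :=
    fun δ => {x | ∃ S, IsRiemannSum g δ.1 c d S ∧ S f = x}
  have hdir : Directed (· ≥ ·) fun δ => 𝓟 (F δ) := by
    intro δ₁ δ₂
    refine ⟨⟨fun t => min (δ₁.1 t) (δ₂.1 t), fun t => lt_min (δ₁.2 t) (δ₂.2 t)⟩, ?_, ?_⟩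
    · exact principal_mono.2 fun x ⟨S, hS, hx⟩ => ⟨S, hS.mono fun t => min_le_left _ _, hx⟩
    · exact principal_mono.2 fun x ⟨S, hS, hx⟩ => ⟨S, hS.mono fun t => min_le_right _ _, hx⟩
  have hne : Nonempty {δ : ℝ → ℝ // ∀ t, 0 < δ t} := ⟨⟨fun _ => 1, fun _ => one_pos⟩⟩
  have hmem : ∀ {s : Set ℝ}, s ∈ (⨅ δ, 𝓟 (F δ)) ↔ ∃ δ, F δ ⊆ s := fun {s} => by
    rw [mem_iInf_of_directed hdir]
    simp
  have hcauchy : Cauchy (⨅ δ, 𝓟 (F δ)) := by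
    refine Metric.cauchy_iff.2 ⟨iInf_neBot_of_directed hdir fun δ => ?_, fun ε hε => ?_⟩
    · obtain ⟨S, hS⟩ := IsRiemannSum.exists_of_le g δ.2 hcd
      exact principal_neBot_iff.2 ⟨_, S, hS, rfl⟩
    · obtain ⟨δ, hδ, hS⟩ := h (ε / 2) (by positivity)
      refine ⟨F ⟨δ, hδ⟩, hmem.2 ⟨_, subset_rfl⟩, ?_⟩
      rintro _ ⟨S, h₁, rfl⟩ _ ⟨S', h₂, rfl⟩
      rw [Real.dist_eq]
      linarith [hS S S' h₁ h₂]
  obtain ⟨I, hI⟩ := CompleteSpace.complete hcauchy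
  refine ⟨I, fun ε hε => ?_⟩
  obtain ⟨δ, hδ⟩ := hmem.1 (hI (Metric.ball_mem_nhds I hε))
  refine ⟨δ.1, δ.2, fun P hP => ?_⟩
  have := hδ ⟨_, IsRiemannSum.of_taggedPartition P hP, rfl⟩
  rwa [Metric.mem_ball, dist_eq_norm] at this

lemma restrict (h : AlmostKSCauchy f g 0 a b) (hac : a ≤ c) (hdb : d ≤ b) :
    AlmostKSCauchy f g 0 c d := by
  intro ε hε
  obtain ⟨δ, hδ, hS⟩ := h ε hε
  obtain ⟨S₁, h₁⟩ := IsRiemannSum.exists_of_le g hδ hac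
  obtain ⟨S₂, h₂⟩ := IsRiemannSum.exists_of_le g hδ hdb
  refine ⟨δ, hδ, fun S S' hS₁ hS₂ => ?_⟩
  have := hS _ _ ((h₁.append hS₁).append h₂) ((h₁.append hS₂).append h₂)
  simpa using this

lemma trans (h₁ : AlmostKSCauchy f g κ c m) (h₂ : AlmostKSCauchy f g κ m d)
    (hm : m ∈ Icc c d) : AlmostKSCauchy f g κ c d := by
  intro ε hε
  obtain ⟨δ₁, hδ₁, hS₁⟩ := h₁ (ε / 2) (by positivity)
  obtain ⟨δ₂, hδ₂, hS₂⟩ := h₂ (ε / 2) (by positivity)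
  refine ⟨fun t => min (min (δ₁ t) (δ₂ t)) (if t = m then 1 else |t - m|), fun t => ?_,
    fun S S' hS hS' => ?_⟩
  · refine lt_min (lt_min (hδ₁ t) (hδ₂ t)) ?_
    split_ifs with ht
    · exact one_pos
    · exact abs_pos.2 (sub_ne_zero.2 ht)
  · have hsep : ∀ t, t ≠ m →
        min (min (δ₁ t) (δ₂ t)) (if t = m then 1 else |t - m|) ≤ |t - m| :=
      fun t ht => (min_le_right _ _).trans (by simp [ht])
    have hle₁ : ∀ t, min (min (δ₁ t) (δ₂ t)) (if t = m then 1 else |t - m|) ≤ δ₁ t :=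
      fun t => (min_le_left _ _).trans (min_le_left _ _)
    have hle₂ : ∀ t, min (min (δ₁ t) (δ₂ t)) (if t = m then 1 else |t - m|) ≤ δ₂ t :=
      fun t => (min_le_left _ _).trans (min_le_right _ _)
    obtain ⟨A, B, hA, hB, hAB⟩ := hS.split hm hsep
    obtain ⟨A', B', hA', hB', hAB'⟩ := hS'.split hm hsep
    have e₁ := abs_le.1 (hS₁ _ _ (hA.mono hle₁) (hA'.mono hle₁))
    have e₂ := abs_le.1 (hS₂ _ _ (hB.mono hle₂) (hB'.mono hle₂))
    rw [hAB, hAB']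
    exact abs_le.2 ⟨by linarith, by linarith⟩

lemma refl : AlmostKSCauchy f g κ c c := by
  intro ε hε
  refine ⟨fun _ => 1, fun _ => one_pos, fun S S' hS hS' => ?_⟩
  have hz : ∀ S, IsRiemannSum g (fun _ => 1) c c S → S f = 0 := fun S hS => by
    have hg : MonotoneOn g (Icc c c) := by simp
    have := hS.abs_le_mul_sub hg (f := f) (M := |f c|) (fun t ht => by
      rw [le_antisymm ht.2 ht.1])
    simpa using this
  simp [hz S hS, hz S' hS', hε.le]

lemma single_right (hg : MonotoneOn g (Icc c d))
    (hlc : Tendsto g (𝓝[Ico c d] d) (𝓝 (g d))) : AlmostKSCauchy (Pi.single d 1) g 0 c d := by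
  rcases le_or_gt d c with hdc | hcd
  · intro ε hε
    rcases hdc.eq_or_lt with rfl | hlt
    · exact refl ε hε
    · exact ⟨fun _ => 1, fun _ => one_pos, fun S S' hS => absurd hS.le (not_le.2 hlt)⟩
  intro ε hε
  have hne : (𝓝[Ico c d] d).NeBot := by
    rw [nhdsWithin_Ico_eq_nhdsLT hcd]
    infer_instance
  obtain ⟨m, hm, hmem⟩ := ((hlc.eventually (lt_mem_nhds (sub_lt_self (g d) hε))).and
    self_mem_nhdsWithin).exists
  refine ⟨fun _ => d - m, fun _ => sub_pos.2 hmem.2, fun S S' hS hS' => ?_⟩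
  have hsingle : ∀ t, (0 : ℝ) ≤ (Pi.single d 1 : ℝ → ℝ) t := fun t => by
    rcases eq_or_ne t d with rfl | hne <;> simp [*]
  have hmax : max 0 (g d - g m) ≤ ε := max_le hε.le (by linarith)
  have u₁ := hS.apply_single_right_le hg ⟨hmem.1, hmem.2.le⟩ le_rfl le_rfl
  have u₂ := hS'.apply_single_right_le hg ⟨hmem.1, hmem.2.le⟩ le_rfl le_rfl
  have l₁ := hS.nonneg hg hsingle
  have l₂ := hS'.nonneg hg hsingle
  exact abs_le.2 ⟨by linarith, by linarith⟩

lemma single_left (hg : MonotoneOn g (Icc c d)) : AlmostKSCauchy (Pi.single c 1) g 0 c d := by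
  rcases le_or_gt d c with hdc | hcd
  · intro ε hε
    rcases hdc.eq_or_lt with rfl | hlt
    · exact refl ε hε
    · exact ⟨fun _ => 1, fun _ => one_pos, fun S S' hS => absurd hS.le (not_le.2 hlt)⟩
  intro ε hε
  have hne : (g '' Ioc c d).Nonempty := (nonempty_Ioc.2 hcd).image g
  have hbdd : BddBelow (g '' Ioc c d) := ⟨g c, by
    rintro _ ⟨t, ht, rfl⟩
    exact hg ⟨le_rfl, hcd.le⟩ ⟨ht.1.le, ht.2⟩ ht.1.le⟩
  obtain ⟨_, ⟨m, hm, rfl⟩, hmlt⟩ :=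
    exists_lt_of_csInf_lt hne (lt_add_of_pos_right (sInf (g '' Ioc c d)) hε)
  have hG : ∀ t ∈ Ioc c d, sInf (g '' Ioc c d) ≤ g t :=
    fun t ht => csInf_le hbdd (mem_image_of_mem g ht)
  have hmI : m ∈ Icc c d := ⟨hm.1.le, hm.2⟩
  have hcm : g c ≤ g m := hg ⟨le_rfl, hcd.le⟩ hmI hm.1.le
  refine ⟨fun t => if t = c then m - c else |t - c|, fun t => ?_, fun S S' hS hS' => ?_⟩
  · beta_reduce
    split_ifs with ht
    · exact sub_pos.2 hm.1
    · exact abs_pos.2 (sub_ne_zero.2 ht)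
  · have hle := min_le_right (g d) (g m)
    have u₁ := hS.apply_single_left_le hg (fun t ht htm => hg ht hmI htm) hcm (by simp)
    have u₂ := hS'.apply_single_left_le hg (fun t ht htm => hg ht hmI htm) hcm (by simp)
    have l₁ := hS.le_apply_single_left hg hG hcd fun t ht => by simp [ht]
    have l₂ := hS'.le_apply_single_left hg hG hcd fun t ht => by simp [ht]
    exact abs_le.2 ⟨by linarith, by linarith⟩

/-- If `f` is within `M` of a linear combination of Cauchy integrands, its Riemann sums oscillate
by at most `2 * M * (g d - g c)`. -/
lemma of_approx {f₁ f₂ : ℝ → ℝ} {M : ℝ} (h₁ : AlmostKSCauchy f₁ g 0 c d)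
    (h₂ : AlmostKSCauchy f₂ g 0 c d) (hg : MonotoneOn g (Icc c d)) (α β : ℝ)
    (hf : ∀ t ∈ Icc c d, |f t - (α * f₁ t + β * f₂ t)| ≤ M) :
    AlmostKSCauchy f g (2 * M) c d := by
  intro ε hε
  have hα : 0 < 2 * (|α| + 1) := by positivity
  have hβ : 0 < 2 * (|β| + 1) := by positivity
  obtain ⟨δ₁, hδ₁, hS₁⟩ := h₁ (ε / (2 * (|α| + 1))) (by positivity)
  obtain ⟨δ₂, hδ₂, hS₂⟩ := h₂ (ε / (2 * (|β| + 1))) (by positivity)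
  refine ⟨fun t => min (δ₁ t) (δ₂ t), fun t => lt_min (hδ₁ t) (hδ₂ t), fun S S' hS hS' => ?_⟩
  set r : ℝ → ℝ := fun t => f t - (α * f₁ t + β * f₂ t) with hr
  have hfr : f = fun t => α * f₁ t + β * f₂ t + r t := by
    funext t
    simp [hr]
  have e₁ := hS₁ _ _ (hS.mono fun t => min_le_left _ _) (hS'.mono fun t => min_le_left _ _)
  have e₂ := hS₂ _ _ (hS.mono fun t => min_le_right _ _) (hS'.mono fun t => min_le_right _ _)
  have r₁ := abs_le.1 (hS.abs_le_mul_sub hg hf)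
  have r₂ := abs_le.1 (hS'.abs_le_mul_sub hg hf)
  have scale : ∀ γ x : ℝ, |x| ≤ 0 * (g d - g c) + ε / (2 * (|γ| + 1)) → |γ * x| ≤ ε / 2 := by
    intro γ x hx
    rw [zero_mul, zero_add, le_div_iff₀ (by positivity)] at hx
    rw [abs_mul]
    nlinarith [abs_nonneg x, abs_nonneg γ]
  have e₃ := abs_le.1 (scale α _ e₁)
  have e₄ := abs_le.1 (scale β _ e₂)
  rw [hfr, hS.linear, hS'.linear]
  exact abs_le.2 ⟨by linarith, by linarith⟩

lemma of_isRiemannSum {δ : ℝ → ℝ} {S : (ℝ → ℝ) → ℝ} (hS : IsRiemannSum g δ c d S)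
    (hloc : ∀ x y τ, c ≤ x → y ≤ d → τ ∈ Icc x y →
      Icc x y ⊆ Ioo (τ - δ τ) (τ + δ τ) → AlmostKSCauchy f g κ x y) :
    AlmostKSCauchy f g κ c d := by
  induction hS with
  | nil => exact refl
  | snoc hS hτ hfine ih =>
    have hxd := hτ.1.trans hτ.2
    exact (ih fun x y τ hx hy => hloc x y τ hx (hy.trans hxd)).trans
      (hloc _ _ _ hS.le le_rfl hτ hfine) ⟨hS.le, hxd⟩

lemma of_forall_pos (h : ∀ κ, 0 < κ → AlmostKSCauchy f g κ c d) : AlmostKSCauchy f g 0 c d := by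
  intro ε hε
  have hpos : 0 < 2 * (|g d - g c| + 1) := by positivity
  obtain ⟨δ, hδ, hS⟩ := h (ε / (2 * (|g d - g c| + 1))) (by positivity) (ε / 2) (by positivity)
  refine ⟨δ, hδ, fun S S' h₁ h₂ => (hS S S' h₁ h₂).trans ?_⟩
  have hle : ε / (2 * (|g d - g c| + 1)) * (g d - g c) ≤ ε / 2 := by
    rw [div_mul_eq_mul_div, div_le_iff₀ hpos]
    nlinarith [le_abs_self (g d - g c)]
  linarith

end AlmostKSCauchy

/-- Near every point of `[a, b]`, a regulated function is almost constant on either side. -/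
lemma RegulatedOn.exists_gauge {u : ℝ → ℝ} {a b ε : ℝ} (hu : RegulatedOn u a b) (hε : 0 < ε) :
    ∃ δ : ℝ → ℝ, (∀ t, 0 < δ t) ∧ ∀ τ ∈ Icc a b,
      (∃ L, ∀ t ∈ Ico a τ, τ - δ τ < t → |u t - L| ≤ ε) ∧
      ∃ R, ∀ t ∈ Ioc τ b, t < τ + δ τ → |u t - R| ≤ ε := by
  have key : ∀ τ, ∃ δ : ℝ, 0 < δ ∧ (τ ∈ Icc a b →
      (∃ L, ∀ t ∈ Ico a τ, τ - δ < t → |u t - L| ≤ ε) ∧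
      ∃ R, ∀ t ∈ Ioc τ b, t < τ + δ → |u t - R| ≤ ε) := by
    intro τ
    by_cases hτ : τ ∈ Icc a b
    · have hleft : ∃ δ : ℝ, 0 < δ ∧ ∃ L, ∀ t ∈ Ico a τ, τ - δ < t → |u t - L| ≤ ε := by
        rcases hτ.1.eq_or_lt with rfl | hlt
        · exact ⟨1, one_pos, 0, by simp⟩
        · obtain ⟨L, hL⟩ := hu.1 τ ⟨hlt, hτ.2⟩
          obtain ⟨δ, hδ, h⟩ := Metric.tendsto_nhdsWithin_nhds.1 hL ε hε
          refine ⟨δ, hδ, L, fun t ht htδ => (h ht ?_).le⟩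
          rw [Real.dist_eq]
          exact abs_lt.2 ⟨by linarith, by linarith [ht.2]⟩
      have hright : ∃ δ : ℝ, 0 < δ ∧ ∃ R, ∀ t ∈ Ioc τ b, t < τ + δ → |u t - R| ≤ ε := by
        rcases hτ.2.eq_or_lt with rfl | hlt
        · exact ⟨1, one_pos, 0, by simp⟩
        · obtain ⟨R, hR⟩ := hu.2 τ ⟨hτ.1, hlt⟩
          obtain ⟨δ, hδ, h⟩ := Metric.tendsto_nhdsWithin_nhds.1 hR ε hε
          refine ⟨δ, hδ, R, fun t ht htδ => (h ht ?_).le⟩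
          rw [Real.dist_eq]
          exact abs_lt.2 ⟨by linarith [ht.1], by linarith⟩
      obtain ⟨δ₁, hδ₁, L, hL⟩ := hleft
      obtain ⟨δ₂, hδ₂, R, hR⟩ := hright
      refine ⟨min δ₁ δ₂, lt_min hδ₁ hδ₂, fun _ => ⟨⟨L, fun t ht h => hL t ht ?_⟩,
        R, fun t ht h => hR t ht ?_⟩⟩
      · linarith [min_le_left δ₁ δ₂]
      · linarith [min_le_right δ₁ δ₂]
    · exact ⟨1, one_pos, fun h => absurd h hτ⟩
  choose δ hδ h using key
  exact ⟨δ, hδ, h⟩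

/-- If `u` is `ε`-close to `L` on `[c, d]` away from the point `p`, then `u * η` is approximated by
`L * η` corrected at `p`. -/
lemma AlmostKSCauchy.mul_of_near_const {g η u : ℝ → ℝ} {c d p L ε C : ℝ}
    (hη : AlmostKSCauchy η g 0 c d) (hp : AlmostKSCauchy (Pi.single p 1) g 0 c d)
    (hg : MonotoneOn g (Icc c d)) (hε : 0 ≤ ε) (hC : 0 ≤ C) (hηC : ∀ t ∈ Icc c d, |η t| ≤ C)
    (hu : ∀ t ∈ Icc c d, t ≠ p → |u t - L| ≤ ε) :
    AlmostKSCauchy (fun t => u t * η t) g (2 * (ε * C)) c d := by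
  refine hη.of_approx hp hg L ((u p - L) * η p) fun t ht => ?_
  rcases eq_or_ne t p with rfl | hne
  · have : u t * η t - (L * η t + (u t - L) * η t * (Pi.single t 1 : ℝ → ℝ) t) = 0 := by
      rw [Pi.single_eq_same]
      ring
    rw [this, abs_zero]
    positivity
  · have : u t * η t - (L * η t + (u p - L) * η p * (Pi.single p 1 : ℝ → ℝ) t)
        = (u t - L) * η t := by
      rw [Pi.single_eq_of_ne hne]
      ring
    rw [this, abs_mul]
    exact mul_le_mul (hu t ht hne) (hηC t ht) (abs_nonneg _) hε

/-- Lemma 3.2: the product of a regulated function and a bounded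
KS-integrable function is KS integrable w.r.t. a nondecreasing left-continuous `g`. -/
theorem ks_integrable_mul_regulated
    (a b : ℝ) (hab : a ≤ b)
    (g : ℝ → ℝ) (hg_mono : MonotoneOn g (Set.Icc a b)) (hg_lc : LeftContinuousOn g a b)
    (η : ℝ → ℝ) (hη_bdd : ∃ C : ℝ, ∀ t ∈ Set.Icc a b, |η t| ≤ C)
    (hη_int : KSIntegrable η g a b)
    (u : ℝ → ℝ) (hu : RegulatedOn u a b) :
    KSIntegrable (fun t => u t * η t) g a b := by
  obtain ⟨C, hC⟩ := hη_bdd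
  have hC0 : 0 ≤ C := (abs_nonneg _).trans (hC a ⟨le_rfl, hab⟩)
  have hη := hη_int.almostKSCauchy
  refine AlmostKSCauchy.ksIntegrable hab (.of_forall_pos fun κ hκ => ?_)
  have hε : 0 < κ / (2 * (C + 1)) := by positivity
  obtain ⟨δ, hδ, hδu⟩ := hu.exists_gauge hε
  obtain ⟨S, hS⟩ := IsRiemannSum.exists_of_le g hδ hab
  refine .of_isRiemannSum hS fun x y τ hx hy hτ hfine => ?_
  have hτab : τ ∈ Icc a b := ⟨hx.trans hτ.1, hτ.2.trans hy⟩
  have hsub₁ : Icc x τ ⊆ Icc a b := Icc_subset_Icc hx hτab.2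
  have hsub₂ : Icc τ y ⊆ Icc a b := Icc_subset_Icc hτab.1 hy
  have hg₁ := hg_mono.mono hsub₁
  have hg₂ := hg_mono.mono hsub₂
  have hxy := hτ.1.trans hτ.2
  obtain ⟨⟨L, hL⟩, R, hR⟩ := hδu τ hτab
  have hlc : Tendsto g (𝓝[Ico x τ] τ) (𝓝 (g τ)) := by
    rcases hτ.1.eq_or_lt with rfl | hlt
    · simp
    · exact (hg_lc τ ⟨hx.trans_lt hlt, hτab.2⟩).mono_left
        (nhdsWithin_mono _ (Ico_subset_Ico_left hx))
  have hleft := (hη.restrict hx hτab.2).mul_of_near_const (u := u) (L := L)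
    (.single_right hg₁ hlc) hg₁ hε.le (hC0.trans (le_add_of_nonneg_right zero_le_one))
    (fun t ht => (hC t (hsub₁ ht)).trans (le_add_of_nonneg_right zero_le_one))
    (fun t ht hne => hL t ⟨hx.trans ht.1, lt_of_le_of_ne ht.2 hne⟩
      (hfine ⟨ht.1, ht.2.trans hτ.2⟩).1)
  have hright := (hη.restrict hτab.1 hy).mul_of_near_const (u := u) (L := R)
    (.single_left hg₂) hg₂ hε.le (hC0.trans (le_add_of_nonneg_right zero_le_one))
    (fun t ht => (hC t (hsub₂ ht)).trans (le_add_of_nonneg_right zero_le_one))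
    (fun t ht hne => hR t ⟨lt_of_le_of_ne ht.1 hne.symm, ht.2.trans hy⟩
      (hfine ⟨hτ.1.trans ht.1, ht.2⟩).2)
  have hκ' : 2 * (κ / (2 * (C + 1)) * (C + 1)) = κ := by
    have : C + 1 ≠ 0 := by positivity
    field_simp
  rw [← hκ']
  exact hleft.trans hright hτ

end HMDEPaper
end

section
/- Let J = [t₀, t₀ + a] with a > 0, let g : J → ℝ be nondecreasing and left-continuous, let f, h : J × ℝⁿ → ℝⁿ satisfy conditions (A0)–(A3), and let x₀ ∈ ℝⁿ. If liminf_{r→∞} φ(r)/r < 1 (where φ is the D-function from (A3)), then there exists a solution of the hybrid measure differential equation on J with data (h, f, g, x₀); that is, there exists a regulated function x : J → ℝⁿ such that x(t₀) = x₀, the function t ↦ h(t, x(t)) is regulated, the KS integral ∫_{t₀}^{t} f(s, x(s)) dg(s) exists for every t ∈ J, and x(t) = x₀ − h(t₀, x₀) + h(t, x(t)) + ∫_{t₀}^{t} f(s, x(s)) dg(s) for all t ∈ J. -/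
open Set Filter Topology

namespace HMDEPaper

section KurzweilStieltjes

namespace TaggedPartition

variable {E : Type*} [NormedAddCommGroup E] [NormedSpace ℝ E]

/-- The tagged partition of `[c, d]` with a single interval. -/
def single (c τ d : ℝ) (hcτ : c ≤ τ) (hτd : τ ≤ d) : TaggedPartition c d where
  n := 1
  npos := one_pos
  s i := if i = 0 then c else d
  τ _ := τ
  s_first := by simp
  s_last := by simp
  s_mono i hi := by
    obtain rfl : i = 0 := by omega
    simpa using hcτ.trans hτd
  tag_mem i hi := by
    obtain rfl : i = 0 := by omega
    simpa using ⟨hcτ, hτd⟩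

theorem single_sum {c τ d : ℝ} (hcτ : c ≤ τ) (hτd : τ ≤ d) (F : ℝ → E) (g : ℝ → ℝ) :
    (single c τ d hcτ hτd).sum F g = (g d - g c) • F τ := by
  simp [TaggedPartition.sum, single]

theorem single_isFine {c τ d : ℝ} (hcτ : c ≤ τ) (hτd : τ ≤ d) {δ : ℝ → ℝ}
    (h : Icc c d ⊆ Ioo (τ - δ τ) (τ + δ τ)) : (single c τ d hcτ hτd).IsFine δ := by
  intro i hi
  obtain rfl : i = 0 := by simp only [single] at hi; omega
  simpa [single] using h

/-- Concatenation of tagged partitions of adjacent intervals. -/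
def concat {a c b : ℝ} (P : TaggedPartition a c) (Q : TaggedPartition c b) :
    TaggedPartition a b where
  n := P.n + Q.n
  npos := Nat.add_pos_left P.npos _
  s i := if i ≤ P.n then P.s i else Q.s (i - P.n)
  τ i := if i < P.n then P.τ i else Q.τ (i - P.n)
  s_first := by simp [P.s_first]
  s_last := by
    have := Q.npos
    simp [Q.s_last, this.ne']
  s_mono i hi := by
    rcases lt_trichotomy i P.n with h | rfl | h
    · simpa [h.le, Nat.succ_le_iff.2 h] using P.s_mono i h
    · have := Q.s_mono 0 Q.npos
      simpa [P.s_last, Q.s_first] using this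
    · have := Q.s_mono (i - P.n) (by omega)
      simpa [h.not_ge, show ¬ i + 1 ≤ P.n by omega,
        show i + 1 - P.n = i - P.n + 1 by omega] using this
  tag_mem i hi := by
    rcases lt_trichotomy i P.n with h | rfl | h
    · simpa [h.le, h, Nat.succ_le_iff.2 h] using P.tag_mem i h
    · have := Q.tag_mem 0 Q.npos
      simpa [P.s_last, Q.s_first] using this
    · have := Q.tag_mem (i - P.n) (by omega)
      simpa [h.not_ge, h.not_gt, show ¬ i + 1 ≤ P.n by omega,
        show i + 1 - P.n = i - P.n + 1 by omega] using this

theorem concat_sum {a c b : ℝ} (P : TaggedPartition a c) (Q : TaggedPartition c b)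
    (F : ℝ → E) (g : ℝ → ℝ) : (P.concat Q).sum F g = P.sum F g + Q.sum F g := by
  simp only [TaggedPartition.sum, concat, Finset.sum_range_add]
  congr 1
  · refine Finset.sum_congr rfl fun i hi => ?_
    rw [Finset.mem_range] at hi
    simp [hi, hi.le, Nat.succ_le_iff.2 hi]
  · refine Finset.sum_congr rfl fun i hi => ?_
    rcases Nat.eq_zero_or_pos i with rfl | h
    · simp [P.s_last, Q.s_first]
    · simp [h.ne', show ¬ P.n + i + 1 ≤ P.n by omega, show P.n + i + 1 - P.n = i + 1 by omega]

theorem concat_isFine {a c b : ℝ} {P : TaggedPartition a c} {Q : TaggedPartition c b}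
    {δ : ℝ → ℝ} (hP : P.IsFine δ) (hQ : Q.IsFine δ) : (P.concat Q).IsFine δ := by
  intro i hi
  simp only [concat] at hi ⊢
  rcases lt_trichotomy i P.n with h | rfl | h
  · simpa [h.le, h, Nat.succ_le_iff.2 h] using hP i h
  · have := hQ 0 Q.npos
    simpa [P.s_last, Q.s_first] using this
  · have := hQ (i - P.n) (by omega)
    simpa [h.not_ge, h.not_gt, show ¬ i + 1 ≤ P.n by omega,
      show i + 1 - P.n = i - P.n + 1 by omega] using this

theorem s_mem {c d : ℝ} (P : TaggedPartition c d) {i : ℕ} (hi : i ≤ P.n) :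
    P.s i ∈ Icc c d := by
  have hmono : ∀ j k, j ≤ k → k ≤ P.n → P.s j ≤ P.s k := by
    intro j k hjk
    induction hjk with
    | refl => exact fun _ => le_rfl
    | step _ ih => exact fun hk => (ih (by omega)).trans (P.s_mono _ hk)
  have h0 := hmono 0 i (Nat.zero_le _) hi
  have h1 := hmono i P.n hi le_rfl
  rw [P.s_first] at h0
  rw [P.s_last] at h1
  exact ⟨h0, h1⟩

theorem IsFine.mono {c d : ℝ} {P : TaggedPartition c d} {δ δ' : ℝ → ℝ} (hP : P.IsFine δ)
    (h : ∀ t, δ t ≤ δ' t) : P.IsFine δ' := fun i hi =>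
  (hP i hi).trans (Ioo_subset_Ioo (by linarith [h (P.τ i)]) (by linarith [h (P.τ i)]))

/-- Cousin's lemma. -/
theorem exists_isFine {δ : ℝ → ℝ} (hδ : ∀ t, 0 < δ t) {c d : ℝ} (hcd : c ≤ d) :
    ∃ P : TaggedPartition c d, P.IsFine δ := by
  set A : Set ℝ := {t | t ∈ Icc c d ∧ ∃ P : TaggedPartition c t, P.IsFine δ} with hA
  have hcA : c ∈ A := by
    refine ⟨⟨le_rfl, hcd⟩, single c c c le_rfl le_rfl, single_isFine _ _ ?_⟩
    intro x hx
    have hx' : x = c := le_antisymm hx.2 hx.1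
    have := hδ c
    subst hx'
    constructor <;> linarith
  have hbdd : BddAbove A := ⟨d, fun t ht => ht.1.2⟩
  set σ := sSup A with hσ
  have hσd : σ ≤ d := csSup_le ⟨c, hcA⟩ fun t ht => ht.1.2
  obtain ⟨t, ⟨htcd, P, hP⟩, ht⟩ := exists_lt_of_lt_csSup ⟨c, hcA⟩
    (show σ - δ σ < sSup A by linarith [hδ σ])
  have htσ : t ≤ σ := le_csSup hbdd ⟨htcd, P, hP⟩
  have hσpos := hδ σ
  set r := min d (σ + δ σ / 2) with hr
  have hσr : σ ≤ r := le_min hσd (by linarith)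
  have hrA : r ∈ A := by
    refine ⟨⟨htcd.1.trans (htσ.trans hσr), min_le_left _ _⟩,
      P.concat (single t σ r htσ hσr), concat_isFine hP (single_isFine _ _ ?_)⟩
    intro x hx
    have := min_le_right d (σ + δ σ / 2)
    exact ⟨ht.trans_le hx.1, by linarith [hx.2]⟩
  have hrσ : r ≤ σ := le_csSup hbdd hrA
  have hrd : r = d := by
    rcases min_choice d (σ + δ σ / 2) with h | h
    · exact h
    · rw [← hr] at h
      linarith
  exact hrd ▸ hrA.2

end TaggedPartition

variable {E : Type*} [NormedAddCommGroup E] [NormedSpace ℝ E]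

theorem HasKSIntegral.proj {n : ℕ} {F : ℝ → En n} {g : ℝ → ℝ} {c d : ℝ} {I : En n}
    (h : HasKSIntegral F g c d I) (i : Fin n) :
    HasKSIntegral (fun t => F t i) g c d (I i) := by
  intro ε hε
  obtain ⟨δ, hδ, H⟩ := h ε hε
  refine ⟨δ, hδ, fun P hP => lt_of_le_of_lt ?_ (H P hP)⟩
  have := PiLp.norm_apply_le (P.sum F g - I) i
  simpa [TaggedPartition.sum] using this

/-- `P` is a primitive of `F` with respect to `g` on `[a, b]` in the variational sense: the error
of a single fine interval is controlled by the increment of a monotone function of small total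
variation. -/
def IsVariationalPrimitive (F : ℝ → E) (g : ℝ → ℝ) (a b : ℝ) (P : ℝ → E) : Prop :=
  ∀ ε : ℝ, 0 < ε → ∃ (δ V : ℝ → ℝ), (∀ t, 0 < δ t) ∧ MonotoneOn V (Icc a b) ∧ V b - V a ≤ ε ∧
    ∀ c τ d, a ≤ c → c ≤ τ → τ ≤ d → d ≤ b → Icc c d ⊆ Ioo (τ - δ τ) (τ + δ τ) →
      ‖(g d - g c) • F τ - (P d - P c)‖ ≤ V d - V c

theorem IsVariationalPrimitive.hasKSIntegral {F P : ℝ → E} {g : ℝ → ℝ} {a b c d : ℝ}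
    (h : IsVariationalPrimitive F g a b P) (hac : a ≤ c) (hcd : c ≤ d) (hdb : d ≤ b) :
    HasKSIntegral F g c d (P d - P c) := by
  intro ε hε
  obtain ⟨δ, V, hδ, hV, hVε, H⟩ := h (ε / 2) (half_pos hε)
  refine ⟨δ, hδ, fun Q hQ => ?_⟩
  have key : Q.sum F g - (P d - P c) = ∑ i ∈ Finset.range Q.n,
      ((g (Q.s (i + 1)) - g (Q.s i)) • F (Q.τ i) - (P (Q.s (i + 1)) - P (Q.s i))) := by
    rw [Finset.sum_sub_distrib, Finset.sum_range_sub (fun i => P (Q.s i)), Q.s_last, Q.s_first]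
    rfl
  have hb : ‖Q.sum F g - (P d - P c)‖ ≤ V d - V c := by
    rw [key]
    calc _ ≤ ∑ i ∈ Finset.range Q.n, (V (Q.s (i + 1)) - V (Q.s i)) := by
          refine norm_sum_le_of_le _ fun i hi => ?_
          rw [Finset.mem_range] at hi
          exact H _ _ _ (hac.trans (Q.s_mem hi.le).1) (Q.tag_mem i hi).1 (Q.tag_mem i hi).2
            ((Q.s_mem hi).2.trans hdb) (hQ i hi)
      _ = V d - V c := by
          rw [Finset.sum_range_sub (fun i => V (Q.s i)), Q.s_last, Q.s_first]
  have h1 := hV ⟨le_rfl, hac.trans (hcd.trans hdb)⟩ ⟨hac, hcd.trans hdb⟩ hac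
  have h2 := hV ⟨hac.trans hcd, hdb⟩ ⟨hac.trans (hcd.trans hdb), le_rfl⟩ hdb
  linarith

theorem norm_le_sum_abs {n : ℕ} (x : En n) : ‖x‖ ≤ ∑ i, |x i| := by
  rw [EuclideanSpace.norm_eq]
  refine Real.sqrt_le_iff.2 ⟨Finset.sum_nonneg fun i _ => abs_nonneg _, ?_⟩
  simpa using Finset.sum_sq_le_sq_sum_of_nonneg (s := Finset.univ)
    (f := fun i => |x i|) fun i _ => abs_nonneg _

theorem exists_pos_forall_le {n : ℕ} (d : Fin n → ℝ) (hd : ∀ i, 0 < d i) :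
    ∃ r > 0, ∀ i, r ≤ d i := by
  have h1 : ∀ᶠ r in 𝓝[>] (0 : ℝ), ∀ i, r ≤ d i :=
    eventually_all.2 fun i => mem_nhdsWithin_of_mem_nhds (Iic_mem_nhds (hd i))
  exact ((eventually_mem_nhdsWithin).and h1).exists

theorem IsVariationalPrimitive.of_proj {n : ℕ} {F P : ℝ → En n} {g : ℝ → ℝ} {a b : ℝ}
    (h : ∀ i, IsVariationalPrimitive (fun t => F t i) g a b (fun t => P t i)) :
    IsVariationalPrimitive F g a b P := by
  intro ε hε
  have hn : (0 : ℝ) < n + 1 := by positivity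
  choose δ V hδ hV hVε H using fun i => h i (ε / (n + 1)) (by positivity)
  choose δ' hδ' hle using fun t => exists_pos_forall_le (fun i => δ i t) fun i => hδ i t
  refine ⟨δ', fun t => ∑ i, V i t, hδ', ?_, ?_, ?_⟩
  · exact fun x hx y hy hxy => Finset.sum_le_sum fun i _ => hV i hx hy hxy
  · rw [← Finset.sum_sub_distrib]
    calc _ ≤ ∑ _i : Fin n, ε / (n + 1) := Finset.sum_le_sum fun i _ => hVε i
      _ = n * (ε / (n + 1)) := by simp
      _ ≤ (n + 1) * (ε / (n + 1)) := by gcongr; linarith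
      _ = ε := by field_simp
  · intro c τ d hac hcτ hτd hdb hsub
    rw [← Finset.sum_sub_distrib]
    refine (norm_le_sum_abs _).trans (Finset.sum_le_sum fun i _ => ?_)
    have := H i c τ d hac hcτ hτd hdb (hsub.trans
      (Ioo_subset_Ioo (by linarith [hle τ i]) (by linarith [hle τ i])))
    simpa using this

/-- A gauge together with a major and a minor function bounding all fine Riemann sums. -/
def MajorMinor (F g : ℝ → ℝ) (a b ε : ℝ) (δ H l : ℝ → ℝ) : Prop :=
  (∀ t, 0 < δ t) ∧ H a = 0 ∧ l a = 0 ∧ H b - l b ≤ ε ∧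
    ∀ c d, a ≤ c → c ≤ d → d ≤ b → ∀ Q : TaggedPartition c d, Q.IsFine δ →
      l d - l c ≤ Q.sum F g ∧ Q.sum F g ≤ H d - H c

theorem HasKSIntegral.exists_majorMinor {F g : ℝ → ℝ} {a b I : ℝ} (hab : a ≤ b)
    (h : HasKSIntegral F g a b I) {ε : ℝ} (hε : 0 < ε) :
    ∃ δ H l, MajorMinor F g a b ε δ H l := by
  obtain ⟨δ, hδ, hI⟩ := h (ε / 2) (half_pos hε)
  set S : ℝ → Set ℝ := fun t => {x | ∃ Q : TaggedPartition a t, Q.IsFine δ ∧ Q.sum F g = x}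
  have hne : ∀ t, a ≤ t → (S t).Nonempty := fun t ht =>
    let ⟨Q, hQ⟩ := TaggedPartition.exists_isFine hδ ht
    ⟨_, Q, hQ, rfl⟩
  have hI' : ∀ x ∈ S b, I - ε / 2 ≤ x ∧ x ≤ I + ε / 2 := by
    rintro x ⟨Q, hQ, rfl⟩
    have := (abs_lt.1 (hI Q hQ))
    constructor <;> linarith [this.1, this.2]
  have hadd : ∀ c d x, x ∈ S c → ∀ Q : TaggedPartition c d, Q.IsFine δ →
      x + Q.sum F g ∈ S d := by
    rintro c d x ⟨P, hP, rfl⟩ Q hQ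
    exact ⟨P.concat Q, TaggedPartition.concat_isFine hP hQ, TaggedPartition.concat_sum P Q F g⟩
  have hbdd : ∀ t, t ≤ b → BddAbove (S t) ∧ BddBelow (S t) := by
    intro t ht
    obtain ⟨Q, hQ⟩ := TaggedPartition.exists_isFine hδ ht
    constructor
    · exact ⟨I + ε / 2 - Q.sum F g, fun x hx => by linarith [(hI' _ (hadd t b x hx Q hQ)).2]⟩
    · exact ⟨I - ε / 2 - Q.sum F g, fun x hx => by linarith [(hI' _ (hadd t b x hx Q hQ)).1]⟩
  have hSa : S a = {0} := by
    refine (Set.eq_singleton_iff_nonempty_unique_mem).2 ⟨hne a le_rfl, ?_⟩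
    rintro x ⟨Q, hQ, rfl⟩
    refine Finset.sum_eq_zero fun i hi => ?_
    rw [Finset.mem_range] at hi
    have h1 := Q.s_mem hi.le
    have h2 := Q.s_mem (Nat.succ_le_iff.2 hi)
    rw [Icc_self, mem_singleton_iff] at h1 h2
    simp [h1, h2]
  refine ⟨δ, fun t => sSup (S t), fun t => sInf (S t), hδ, by simp [hSa], by simp [hSa], ?_, ?_⟩
  · have h1 : sSup (S b) ≤ I + ε / 2 := csSup_le (hne b hab) fun x hx => (hI' x hx).2
    have h2 : I - ε / 2 ≤ sInf (S b) := le_csInf (hne b hab) fun x hx => (hI' x hx).1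
    simp only
    linarith
  · intro c d hac hcd hdb Q hQ
    have h1 : sInf (S d) - Q.sum F g ≤ sInf (S c) := le_csInf (hne c hac) fun x hx => by
      linarith [csInf_le (hbdd d hdb).2 (hadd c d x hx Q hQ)]
    have h2 : sSup (S c) ≤ sSup (S d) - Q.sum F g := csSup_le (hne c hac) fun x hx => by
      linarith [le_csSup (hbdd d hdb).1 (hadd c d x hx Q hQ)]
    constructor <;> simp only <;> linarith

theorem MajorMinor.le_of_both {F g : ℝ → ℝ} {a b ε ε' : ℝ} {δ H l δ' H' l' : ℝ → ℝ}
    (h : MajorMinor F g a b ε δ H l) (h' : MajorMinor F g a b ε' δ' H' l') {c d : ℝ}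
    (hac : a ≤ c) (hcd : c ≤ d) (hdb : d ≤ b) : l d - l c ≤ H' d - H' c := by
  obtain ⟨Q, hQ⟩ := TaggedPartition.exists_isFine (δ := fun t => min (δ t) (δ' t))
    (fun t => lt_min (h.1 t) (h'.1 t)) hcd
  exact (h.2.2.2.2 c d hac hcd hdb Q (hQ.mono fun t => min_le_left _ _)).1.trans
    (h'.2.2.2.2 c d hac hcd hdb Q (hQ.mono fun t => min_le_right _ _)).2

theorem HasKSIntegral.exists_isVariationalPrimitive {F g : ℝ → ℝ} {a b I : ℝ} (hab : a ≤ b)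
    (h : HasKSIntegral F g a b I) : ∃ P, IsVariationalPrimitive F g a b P := by
  choose δ H l hM using fun k : ℕ =>
    h.exists_majorMinor hab (Nat.one_div_pos_of_nat (α := ℝ) (n := k))
  have hval : ∀ j k t, a ≤ t → t ≤ b → l j t ≤ H k t := fun j k t hat htb => by
    have := (hM j).le_of_both (hM k) le_rfl hat htb
    linarith [(hM j).2.2.1, (hM k).2.1]
  have hgap : ∀ k t, a ≤ t → t ≤ b → H k t - l k t ≤ 1 / ((k : ℝ) + 1) := fun k t hat htb => by
    have := (hM k).le_of_both (hM k) hat htb le_rfl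
    linarith [(hM k).2.2.2.1]
  set P : ℝ → ℝ := fun t => ⨅ k, H k t
  have hPH : ∀ k t, a ≤ t → t ≤ b → P t ≤ H k t := fun k t hat htb =>
    ciInf_le ⟨l 0 t, by rintro _ ⟨k, rfl⟩; exact hval 0 k t hat htb⟩ k
  have hlP : ∀ k t, a ≤ t → t ≤ b → l k t ≤ P t := fun k t hat htb =>
    le_ciInf fun j => hval k j t hat htb
  have hinc : ∀ k c d, a ≤ c → c ≤ d → d ≤ b →
      l k d - l k c ≤ P d - P c ∧ P d - P c ≤ H k d - H k c := by
    intro k c d hac hcd hdb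
    have hlim : Tendsto (fun j : ℕ => 1 / ((j : ℝ) + 1)) atTop (𝓝 0) :=
      tendsto_one_div_add_atTop_nhds_zero_nat
    have hc := hcd.trans hdb
    have hd := hac.trans hcd
    constructor
    · refine ge_of_tendsto' (x := atTop) (f := fun j : ℕ => P d - P c + 1 / ((j : ℝ) + 1))
        (by simpa using hlim.const_add (P d - P c)) fun j => ?_
      linarith [(hM k).le_of_both (hM j) hac hcd hdb, hPH j c hac hc, hlP j c hac hc,
        hPH j d hd hdb, hlP j d hd hdb, hgap j d hd hdb, hgap j c hac hc]
    · refine ge_of_tendsto' (x := atTop) (f := fun j : ℕ => H k d - H k c + 1 / ((j : ℝ) + 1))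
        (by simpa using hlim.const_add (H k d - H k c)) fun j => ?_
      linarith [(hM j).le_of_both (hM k) hac hcd hdb, hPH j c hac hc, hlP j c hac hc,
        hPH j d hd hdb, hlP j d hd hdb, hgap j d hd hdb, hgap j c hac hc]
  refine ⟨P, fun ε hε => ?_⟩
  obtain ⟨k, hk⟩ := exists_nat_one_div_lt hε
  refine ⟨δ k, fun t => H k t - l k t, (hM k).1, ?_, ?_, ?_⟩
  · intro c hc d hd hcd
    have := (hM k).le_of_both (hM k) hc.1 hcd hd.2
    simp only
    linarith
  · linarith [(hM k).2.1, (hM k).2.2.1, (hM k).2.2.2.1]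
  · intro c τ d hac hcτ hτd hdb hsub
    have h1 := (hM k).2.2.2.2 c d hac (hcτ.trans hτd) hdb _
      (TaggedPartition.single_isFine hcτ hτd hsub)
    have h2 := hinc k c d hac (hcτ.trans hτd) hdb
    rw [TaggedPartition.single_sum] at h1
    rw [Real.norm_eq_abs, abs_le]
    constructor <;> linarith [h1.1, h1.2, h2.1, h2.2]

theorem KSIntegrable.exists_isVariationalPrimitive {n : ℕ} {F : ℝ → En n} {g : ℝ → ℝ} {a b : ℝ}
    (hab : a ≤ b) (h : KSIntegrable F g a b) : ∃ P, IsVariationalPrimitive F g a b P := by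
  obtain ⟨I, hI⟩ := h
  choose P hP using fun i => (hI.proj i).exists_isVariationalPrimitive hab
  exact ⟨fun t => WithLp.toLp 2 fun i => P i t, .of_proj fun i => hP i⟩

end KurzweilStieltjes

section Measure

open MeasureTheory

theorem setIntegral_Ico_sub {E : Type*} [NormedAddCommGroup E] [NormedSpace ℝ E]
    {μ : Measure ℝ} {F : ℝ → E} (hF : Integrable F μ) {a c d : ℝ} (hac : a ≤ c) (hcd : c ≤ d) :
    ∫ s in Ico a d, F s ∂μ - ∫ s in Ico a c, F s ∂μ = ∫ s in Ico c d, F s ∂μ := by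
  rw [← Ico_union_Ico_eq_Ico hac hcd, setIntegral_union
    ((Ico_disjoint_Ico_same)) measurableSet_Ico hF.integrableOn hF.integrableOn]
  abel

theorem isVariationalPrimitive_of_integrable_real {μ : Measure ℝ} [IsFiniteMeasure μ]
    {g F : ℝ → ℝ} {a b : ℝ}
    (hμ : ∀ c d, a ≤ c → c ≤ d → d ≤ b → μ.real (Ico c d) = g d - g c) (hF : Integrable F μ) :
    IsVariationalPrimitive F g a b (fun t => ∫ s in Ico a t, F s ∂μ) := by
  intro ε hε
  obtain ⟨u, hFu, hu, hui, huT, huε⟩ := exists_lt_lowerSemicontinuous_integral_lt F hF (half_pos hε)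
  obtain ⟨l, hlF, hl, hli, hlB, hlε⟩ := exists_upperSemicontinuous_lt_integral_gt F hF (half_pos hε)
  have hFu' : ∀ᵐ s ∂μ, F s ≤ (u s).toReal := by
    filter_upwards [huT] with s hs
    exact EReal.coe_le_coe_iff.1 ((hFu s).le.trans (EReal.le_coe_toReal hs.ne))
  have hlF' : ∀ᵐ s ∂μ, (l s).toReal ≤ F s := by
    filter_upwards [hlB] with s hs
    exact EReal.coe_le_coe_iff.1 ((EReal.coe_toReal_le hs.ne').trans (hlF s).le)
  have hδ : ∀ t, ∃ δ > 0, ∀ s ∈ Ioo (t - δ) (t + δ), (F t : EReal) < u s ∧ l s < F t := by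
    intro t
    have := (hu t _ (hFu t)).and (hl t _ (hlF t))
    obtain ⟨δ, hδ, h⟩ := Metric.eventually_nhds_iff_ball.1 this
    exact ⟨δ, hδ, fun s hs => h s (by rwa [Real.ball_eq_Ioo])⟩
  choose δ hδpos hδ using hδ
  have hint : Integrable (fun s => (u s).toReal - (l s).toReal) μ := hui.sub hli
  have hnn : ∀ᵐ s ∂μ, 0 ≤ (u s).toReal - (l s).toReal := by
    filter_upwards [hFu', hlF'] with s h1 h2
    linarith
  refine ⟨δ, fun t => ∫ s in Ico a t, ((u s).toReal - (l s).toReal) ∂μ, hδpos, ?_, ?_, ?_⟩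
  · intro c hc d hd hcd
    exact setIntegral_mono_set hint.integrableOn (ae_restrict_of_ae hnn)
      (Ico_subset_Ico_right hcd).eventuallyLE
  · have h1 := setIntegral_le_integral (s := Ico a b) hint hnn
    rw [integral_sub hui hli] at h1
    simp only [Ico_self, setIntegral_empty, sub_zero]
    linarith
  · intro c τ d hac hcτ hτd hdb hsub
    have hcd := hcτ.trans hτd
    rw [setIntegral_Ico_sub hF hac hcd, setIntegral_Ico_sub hint hac hcd,
      integral_sub hui.integrableOn hli.integrableOn]
    have hconst : ∫ _s in Ico c d, F τ ∂μ = (g d - g c) * F τ := by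
      rw [setIntegral_const, hμ c d hac hcd hdb, smul_eq_mul]
    have hci : IntegrableOn (fun _ => F τ) (Ico c d) μ := integrable_const _
    have h1 : (g d - g c) * F τ ≤ ∫ s in Ico c d, (u s).toReal ∂μ := by
      rw [← hconst]
      refine setIntegral_mono_on_ae hci hui.integrableOn measurableSet_Ico ?_
      filter_upwards [huT] with s hs hsI
      exact EReal.coe_le_coe_iff.1
        ((hδ τ s (hsub (Ico_subset_Icc_self hsI))).1.le.trans (EReal.le_coe_toReal hs.ne))
    have h2 : ∫ s in Ico c d, (l s).toReal ∂μ ≤ (g d - g c) * F τ := by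
      rw [← hconst]
      refine setIntegral_mono_on_ae hli.integrableOn hci measurableSet_Ico ?_
      filter_upwards [hlB] with s hs hsI
      exact EReal.coe_le_coe_iff.1
        ((EReal.coe_toReal_le hs.ne').trans (hδ τ s (hsub (Ico_subset_Icc_self hsI))).2.le)
    have h3 : ∫ s in Ico c d, F s ∂μ ≤ ∫ s in Ico c d, (u s).toReal ∂μ :=
      setIntegral_mono_ae hF.integrableOn hui.integrableOn hFu'
    have h4 : ∫ s in Ico c d, (l s).toReal ∂μ ≤ ∫ s in Ico c d, F s ∂μ :=
      setIntegral_mono_ae hli.integrableOn hF.integrableOn hlF'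
    rw [Real.norm_eq_abs, abs_le, smul_eq_mul]
    constructor <;> linarith

theorem isVariationalPrimitive_of_integrable {n : ℕ} {μ : Measure ℝ} [IsFiniteMeasure μ]
    {g : ℝ → ℝ} {F : ℝ → En n} {a b : ℝ}
    (hμ : ∀ c d, a ≤ c → c ≤ d → d ≤ b → μ.real (Ico c d) = g d - g c) (hF : Integrable F μ) :
    IsVariationalPrimitive F g a b (fun t => ∫ s in Ico a t, F s ∂μ) := by
  refine .of_proj fun i => ?_
  have hFi : Integrable (fun t => F t i) μ := (EuclideanSpace.proj (𝕜 := ℝ) i).integrable_comp hF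
  have hint : (fun t => (∫ s in Ico a t, F s ∂μ) i) = fun t => ∫ s in Ico a t, F s i ∂μ :=
    funext fun t => ((EuclideanSpace.proj (𝕜 := ℝ) i).integral_comp_comm
      (μ := μ.restrict (Ico a t)) hF.integrableOn).symm
  rw [hint]
  exact isVariationalPrimitive_of_integrable_real hμ hFi

/-- The cell containing `t` after `k` bisections of `[c, d)`. -/
noncomputable def dyadicCell : ℕ → ℝ → ℝ → ℝ → ℝ × ℝ
  | 0, c, d, _ => (c, d)
  | k + 1, c, d, t =>
    if t < (c + d) / 2 then dyadicCell k c ((c + d) / 2) t else dyadicCell k ((c + d) / 2) d t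

theorem dyadicCell_spec (k : ℕ) {c d t : ℝ} (ht : t ∈ Ico c d) :
    c ≤ (dyadicCell k c d t).1 ∧ (dyadicCell k c d t).2 ≤ d ∧
      t ∈ Ico (dyadicCell k c d t).1 (dyadicCell k c d t).2 ∧
      (dyadicCell k c d t).2 - (dyadicCell k c d t).1 = (d - c) / 2 ^ k := by
  induction k generalizing c d with
  | zero => simpa [dyadicCell] using ht
  | succ k ih =>
    have hcd := ht.1.trans_lt ht.2
    rw [dyadicCell]
    split_ifs with h
    · obtain ⟨h1, h2, h3, h4⟩ := ih (c := c) (d := (c + d) / 2) ⟨ht.1, h⟩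
      refine ⟨h1, h2.trans (by linarith), h3, h4.trans ?_⟩
      rw [pow_succ]
      field_simp
      ring
    · obtain ⟨h1, h2, h3, h4⟩ := ih (c := (c + d) / 2) (d := d) ⟨not_lt.1 h, ht.2⟩
      refine ⟨le_trans (by linarith) h1, h2, h3, h4.trans ?_⟩
      rw [pow_succ]
      field_simp
      ring

theorem stronglyMeasurable_dyadicCell {E : Type*} [TopologicalSpace E] (Φ : ℝ × ℝ → E)
    (k : ℕ) (c d : ℝ) : StronglyMeasurable fun t : ℝ => Φ (dyadicCell k c d t) := by
  induction k generalizing c d with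
  | zero => exact stronglyMeasurable_const (b := Φ (c, d))
  | succ k ih =>
    have : (fun t => Φ (dyadicCell (k + 1) c d t)) = fun t =>
        if t < (c + d) / 2 then Φ (dyadicCell k c ((c + d) / 2) t)
        else Φ (dyadicCell k ((c + d) / 2) d t) := by
      funext t
      rw [dyadicCell]
      split_ifs <;> rfl
    rw [this]
    exact StronglyMeasurable.ite measurableSet_Iio (ih _ _) (ih _ _)

/-- A maximal inequality for bad dyadic cells. -/
theorem measure_exists_dyadicCell_le {μ : Measure ℝ} {V : ℝ → ℝ} {a b : ℝ}
    (hV : MonotoneOn V (Icc a b)) (Bad : ℝ × ℝ → Prop)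
    (hBad : ∀ c d, a ≤ c → c ≤ d → d ≤ b → Bad (c, d) →
      μ (Ico c d) ≤ ENNReal.ofReal (V d - V c)) (hab : a ≤ b) :
    μ {t | t ∈ Ico a b ∧ ∃ k, Bad (dyadicCell k a b t)} ≤ ENNReal.ofReal (V b - V a) := by
  have hfin : ∀ N : ℕ, ∀ c d, a ≤ c → c ≤ d → d ≤ b →
      μ {t | t ∈ Ico c d ∧ ∃ k ≤ N, Bad (dyadicCell k c d t)} ≤ ENNReal.ofReal (V d - V c) := by
    intro N
    induction N with
    | zero =>
      intro c d hac hcd hdb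
      by_cases hb : Bad (c, d)
      · exact (measure_mono fun t ht => ht.1).trans (hBad c d hac hcd hdb hb)
      · simp [dyadicCell, hb]
    | succ N ih =>
      intro c d hac hcd hdb
      by_cases hb : Bad (c, d)
      · exact (measure_mono fun t ht => ht.1).trans (hBad c d hac hcd hdb hb)
      have h1 : c ≤ (c + d) / 2 := by linarith
      have h2 : (c + d) / 2 ≤ d := by linarith
      have hsub : {t | t ∈ Ico c d ∧ ∃ k ≤ N + 1, Bad (dyadicCell k c d t)} ⊆
          {t | t ∈ Ico c ((c + d) / 2) ∧ ∃ k ≤ N, Bad (dyadicCell k c ((c + d) / 2) t)} ∪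
          {t | t ∈ Ico ((c + d) / 2) d ∧ ∃ k ≤ N, Bad (dyadicCell k ((c + d) / 2) d t)} := by
        rintro t ⟨ht, k, hk, hbk⟩
        rcases k with _ | k
        · exact absurd hbk hb
        · rw [dyadicCell] at hbk
          split_ifs at hbk with h
          · exact Or.inl ⟨⟨ht.1, h⟩, k, by omega, hbk⟩
          · exact Or.inr ⟨⟨not_lt.1 h, ht.2⟩, k, by omega, hbk⟩
      have hm : (c + d) / 2 ∈ Icc a b := ⟨hac.trans h1, h2.trans hdb⟩
      calc _ ≤ _ := measure_mono hsub
        _ ≤ _ := measure_union_le _ _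
        _ ≤ ENNReal.ofReal (V ((c + d) / 2) - V c) + ENNReal.ofReal (V d - V ((c + d) / 2)) :=
          add_le_add (ih _ _ hac h1 hm.2) (ih _ _ hm.1 h2 hdb)
        _ = ENNReal.ofReal (V d - V c) := by
          rw [← ENNReal.ofReal_add
            (sub_nonneg.2 (hV ⟨hac, hcd.trans hdb⟩ hm h1))
            (sub_nonneg.2 (hV hm ⟨hac.trans hcd, hdb⟩ h2))]
          congr 1
          ring
  have hU : {t | t ∈ Ico a b ∧ ∃ k, Bad (dyadicCell k a b t)} =
      ⋃ N : ℕ, {t | t ∈ Ico a b ∧ ∃ k ≤ N, Bad (dyadicCell k a b t)} := by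
    ext t
    simp only [mem_ofPred_eq, mem_iUnion]
    exact ⟨fun ⟨ht, k, hk⟩ => ⟨k, ht, k, le_rfl, hk⟩, fun ⟨_, ht, k, _, hk⟩ => ⟨ht, k, hk⟩⟩
  have hmono : Monotone fun N : ℕ => {t | t ∈ Ico a b ∧ ∃ k ≤ N, Bad (dyadicCell k a b t)} :=
    fun N N' hN t ht => ⟨ht.1, ht.2.imp fun k hk => ⟨hk.1.trans hN, hk.2⟩⟩
  rw [hU, hmono.measure_iUnion]
  exact iSup_le fun N => hfin N a b le_rfl hab le_rfl

/-- The difference quotient of `P` with respect to `g` over an interval. -/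
noncomputable def diffQuot {E : Type*} [NormedAddCommGroup E] [NormedSpace ℝ E] (P : ℝ → E)
    (g : ℝ → ℝ) (I : ℝ × ℝ) : E :=
  (g I.2 - g I.1)⁻¹ • (P I.2 - P I.1)

theorem IsVariationalPrimitive.ae_tendsto_diffQuot {E : Type*} [NormedAddCommGroup E]
    [NormedSpace ℝ E] {μ : Measure ℝ} [IsFiniteMeasure μ] {F P : ℝ → E} {g : ℝ → ℝ} {a b : ℝ}
    (hab : a ≤ b) (hμ : ∀ c d, a ≤ c → c ≤ d → d ≤ b → μ.real (Ico c d) = g d - g c)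
    (hP : IsVariationalPrimitive F g a b P) :
    ∀ᵐ t ∂μ, t ∈ Ico a b →
      Tendsto (fun k => diffQuot P g (dyadicCell k a b t)) atTop (𝓝 (F t)) := by
  set A : ℕ → Set ℝ := fun j => {t | t ∈ Ico a b ∧ ∃ᶠ k in atTop,
    1 / ((j : ℝ) + 1) < ‖diffQuot P g (dyadicCell k a b t) - F t‖} with hA
  have hA0 : ∀ j, μ (A j) = 0 := by
    intro j
    have hj : (0 : ℝ) < j + 1 := by positivity
    refine le_antisymm (le_of_forall_pos_le_add fun η hη => ?_) (zero_le)
    rw [zero_add]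
    by_cases hηtop : η = ⊤
    · simp [hηtop]
    set ε := η.toReal / (j + 1) with hεdef
    have hηpos : 0 < η.toReal := ENNReal.toReal_pos hη.ne' hηtop
    obtain ⟨δ, V, hδ, hV, hVε, H⟩ := hP ε (by positivity)
    have hAU : A j = ⋃ n : ℕ, {t | t ∈ A j ∧ 1 / ((n : ℝ) + 1) ≤ δ t} := by
      ext t
      simp only [mem_iUnion, mem_ofPred_eq]
      exact ⟨fun ht => let ⟨n, hn⟩ := exists_nat_one_div_lt (hδ t); ⟨n, ht, hn.le⟩,
        fun ⟨_, ht, _⟩ => ht⟩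
    have hAmono : Monotone fun n : ℕ => {t | t ∈ A j ∧ 1 / ((n : ℝ) + 1) ≤ δ t} :=
      fun N N' hN t ht => ⟨ht.1, (Nat.one_div_le_one_div hN).trans ht.2⟩
    rw [hAU, hAmono.measure_iUnion]
    refine iSup_le fun n => ?_
    set Bad : ℝ × ℝ → Prop := fun I => I.2 - I.1 < 1 / ((n : ℝ) + 1) ∧
      ∃ t ∈ Ico I.1 I.2, 1 / ((n : ℝ) + 1) ≤ δ t ∧
        1 / ((j : ℝ) + 1) < ‖diffQuot P g I - F t‖ with hBad
    have hmono : MonotoneOn (fun t => (j + 1 : ℝ) * V t) (Icc a b) := fun x hx y hy hxy =>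
      mul_le_mul_of_nonneg_left (hV hx hy hxy) hj.le
    have hle := measure_exists_dyadicCell_le (μ := μ) hmono Bad ?_ hab
    · refine (measure_mono ?_).trans (hle.trans ?_)
      · rintro t ⟨⟨ht, hfr⟩, hδt⟩
        have hlim : Tendsto (fun k : ℕ => (b - a) / 2 ^ k) atTop (𝓝 0) := by
          simpa [div_eq_mul_inv] using
            (tendsto_pow_atTop_nhds_zero_of_lt_one (r := (2 : ℝ)⁻¹) (by norm_num)
              (by norm_num)).const_mul (b - a)
        obtain ⟨k, hk1, hk2⟩ := (hfr.and_eventually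
          (hlim.eventually (gt_mem_nhds (Nat.one_div_pos_of_nat (n := n))))).exists
        have hsp := dyadicCell_spec k ht
        exact ⟨ht, k, by rwa [hsp.2.2.2], t, hsp.2.2.1, hδt, hk1⟩
      · rw [← ENNReal.ofReal_toReal hηtop]
        refine ENNReal.ofReal_le_ofReal ?_
        calc (j + 1 : ℝ) * V b - (j + 1) * V a = (j + 1) * (V b - V a) := by ring
          _ ≤ (j + 1) * ε := by gcongr
          _ = η.toReal := by rw [hεdef]; field_simp
    · rintro c d hac hcd hdb ⟨hlt, t, ht, hδt, hbig⟩
      have hsub : Icc c d ⊆ Ioo (t - δ t) (t + δ t) := by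
        intro x hx
        simp only at ht hlt
        constructor <;> linarith [hx.1, hx.2, ht.1, ht.2]
      have hv := H c t d hac ht.1 ht.2.le hdb hsub
      have hg : 0 ≤ g d - g c := by rw [← hμ c d hac hcd hdb]; exact measureReal_nonneg
      rw [← ENNReal.ofReal_toReal (measure_ne_top μ (Ico c d))]
      refine ENNReal.ofReal_le_ofReal ?_
      change μ.real _ ≤ _
      rw [hμ c d hac hcd hdb, ← mul_sub]
      rcases hg.eq_or_lt with h0 | hpos
      · rw [← h0]
        exact mul_nonneg hj.le ((norm_nonneg _).trans hv)
      · have heq : (g d - g c) • F t - (P d - P c) =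
            -((g d - g c) • (diffQuot P g (c, d) - F t)) := by
          rw [diffQuot, smul_sub, smul_smul, mul_inv_cancel₀ hpos.ne', one_smul]
          abel
        rw [heq, norm_neg, norm_smul, Real.norm_of_nonneg hg] at hv
        have h5 : (g d - g c) * (1 / ((j : ℝ) + 1)) ≤ V d - V c :=
          (mul_le_mul_of_nonneg_left hbig.le hg).trans hv
        rw [mul_one_div, div_le_iff₀ hj] at h5
        linarith
  have hall : ∀ᵐ t ∂μ, ∀ j, t ∉ A j := ae_all_iff.2 fun j => measure_eq_zero_iff_ae_notMem.1 (hA0 j)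
  filter_upwards [hall] with t ht htI
  refine Metric.tendsto_atTop'.2 fun ε hε => ?_
  obtain ⟨j, hj⟩ := exists_nat_one_div_lt hε
  have h1 := ht j
  simp only [hA, mem_ofPred_eq, htI, true_and, not_frequently, not_lt] at h1
  obtain ⟨N, hN⟩ := eventually_atTop.1 h1
  exact ⟨N, fun k hk => by rw [dist_eq_norm]; exact (hN k hk.le).trans_lt hj⟩

theorem IsVariationalPrimitive.aestronglyMeasurable {E : Type*} [NormedAddCommGroup E]
    [NormedSpace ℝ E] {μ : Measure ℝ} [IsFiniteMeasure μ] {F P : ℝ → E} {g : ℝ → ℝ} {a b : ℝ}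
    (hab : a ≤ b) (hμ : ∀ c d, a ≤ c → c ≤ d → d ≤ b → μ.real (Ico c d) = g d - g c)
    (hsupp : ∀ᵐ t ∂μ, t ∈ Ico a b)
    (hP : IsVariationalPrimitive F g a b P) : AEStronglyMeasurable F μ := by
  refine aestronglyMeasurable_of_tendsto_ae atTop
    (f := fun k t => diffQuot P g (dyadicCell k a b t))
    (fun k => (stronglyMeasurable_dyadicCell _ k a b).aestronglyMeasurable) ?_
  filter_upwards [hP.ae_tendsto_diffQuot hab hμ, hsupp] with t h1 h2 using h1 h2

theorem IsVariationalPrimitive.ae_norm_le {E : Type*} [NormedAddCommGroup E]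
    [NormedSpace ℝ E] {μ : Measure ℝ} [IsFiniteMeasure μ] {F P : ℝ → E} {M m g : ℝ → ℝ} {a b : ℝ}
    (hab : a ≤ b) (hμ : ∀ c d, a ≤ c → c ≤ d → d ≤ b → μ.real (Ico c d) = g d - g c)
    (hsupp : ∀ᵐ t ∂μ, t ∈ Ico a b)
    (hP : IsVariationalPrimitive F g a b P) (hm : IsVariationalPrimitive M g a b m)
    (hle : ∀ c d, a ≤ c → c ≤ d → d ≤ b → ‖P d - P c‖ ≤ m d - m c) : ∀ᵐ t ∂μ, ‖F t‖ ≤ M t := by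
  filter_upwards [hP.ae_tendsto_diffQuot hab hμ, hm.ae_tendsto_diffQuot hab hμ, hsupp]
    with t h1 h2 ht
  refine le_of_tendsto_of_tendsto' (h1 ht).norm (h2 ht) fun k => ?_
  obtain ⟨hc, hd, htI, -⟩ := dyadicCell_spec k ht
  have hcd := (htI.1.trans_lt htI.2).le
  have hg : 0 ≤ g (dyadicCell k a b t).2 - g (dyadicCell k a b t).1 := by
    rw [← hμ _ _ hc hcd hd]; exact measureReal_nonneg
  rw [diffQuot, diffQuot, norm_smul, norm_inv, Real.norm_of_nonneg hg, smul_eq_mul]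
  exact mul_le_mul_of_nonneg_left (hle _ _ hc hcd hd) (inv_nonneg.2 hg)

theorem lintegral_diffQuot_dyadicCell_le {μ : Measure ℝ} [IsFiniteMeasure μ] {m g : ℝ → ℝ}
    {a b : ℝ} (hμ : ∀ c d, a ≤ c → c ≤ d → d ≤ b → μ.real (Ico c d) = g d - g c)
    (hm : MonotoneOn m (Icc a b)) (k : ℕ) {c d : ℝ} (hac : a ≤ c) (hcd : c ≤ d) (hdb : d ≤ b) :
    ∫⁻ t in Ico c d, ENNReal.ofReal (diffQuot m g (dyadicCell k c d t)) ∂μ ≤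
      ENNReal.ofReal (m d - m c) := by
  induction k generalizing c d with
  | zero =>
    have hg : 0 ≤ g d - g c := by rw [← hμ c d hac hcd hdb]; exact measureReal_nonneg
    have hmm : 0 ≤ m d - m c := sub_nonneg.2 (hm ⟨hac, hcd.trans hdb⟩ ⟨hac.trans hcd, hdb⟩ hcd)
    have hI : μ (Ico c d) = ENNReal.ofReal (g d - g c) := by
      rw [← hμ c d hac hcd hdb]
      exact (ENNReal.ofReal_toReal (measure_ne_top _ _)).symm
    simp only [dyadicCell, diffQuot, smul_eq_mul]
    rw [setLIntegral_const, hI, ← ENNReal.ofReal_mul (by positivity)]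
    refine ENNReal.ofReal_le_ofReal ?_
    rcases hg.eq_or_lt with h0 | hpos
    · rw [← h0]; simpa using hmm
    · exact le_of_eq (by field_simp)
  | succ k ih =>
    have h1 : c ≤ (c + d) / 2 := by linarith
    have h2 : (c + d) / 2 ≤ d := by linarith
    have hm' : (c + d) / 2 ∈ Icc a b := ⟨hac.trans h1, h2.trans hdb⟩
    rw [← Ico_union_Ico_eq_Ico h1 h2, lintegral_union measurableSet_Ico Ico_disjoint_Ico_same]
    have e1 : ∫⁻ t in Ico c ((c + d) / 2),
          ENNReal.ofReal (diffQuot m g (dyadicCell (k + 1) c d t)) ∂μ =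
        ∫⁻ t in Ico c ((c + d) / 2),
          ENNReal.ofReal (diffQuot m g (dyadicCell k c ((c + d) / 2) t)) ∂μ :=
      setLIntegral_congr_fun measurableSet_Ico fun t ht => by
        simp only [dyadicCell, if_pos ht.2]
    have e2 : ∫⁻ t in Ico ((c + d) / 2) d,
          ENNReal.ofReal (diffQuot m g (dyadicCell (k + 1) c d t)) ∂μ =
        ∫⁻ t in Ico ((c + d) / 2) d,
          ENNReal.ofReal (diffQuot m g (dyadicCell k ((c + d) / 2) d t)) ∂μ :=
      setLIntegral_congr_fun measurableSet_Ico fun t ht => by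
        simp only [dyadicCell, if_neg (not_lt.2 ht.1)]
    rw [e1, e2]
    refine (add_le_add (ih hac h1 hm'.2) (ih hm'.1 h2 hdb)).trans (le_of_eq ?_)
    rw [← ENNReal.ofReal_add (sub_nonneg.2 (hm ⟨hac, hcd.trans hdb⟩ hm' h1))
      (sub_nonneg.2 (hm hm' ⟨hac.trans hcd, hdb⟩ h2))]
    congr 1
    ring

theorem IsVariationalPrimitive.integrable_of_nonneg {μ : Measure ℝ} [IsFiniteMeasure μ]
    {M m g : ℝ → ℝ} {a b : ℝ}
    (hab : a ≤ b) (hμ : ∀ c d, a ≤ c → c ≤ d → d ≤ b → μ.real (Ico c d) = g d - g c)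
    (hsupp : ∀ᵐ t ∂μ, t ∈ Ico a b) (hM : IsVariationalPrimitive M g a b m)
    (hm : MonotoneOn m (Icc a b)) (hnn : ∀ᵐ t ∂μ, 0 ≤ M t) : Integrable M μ := by
  refine ⟨hM.aestronglyMeasurable hab hμ hsupp, ?_⟩
  rw [hasFiniteIntegral_iff_ofReal hnn]
  have hres : μ.restrict (Ico a b) = μ := Measure.restrict_eq_self_of_ae_mem hsupp
  have hlim : ∫⁻ t, ENNReal.ofReal (M t) ∂μ = ∫⁻ t, liminf
      (fun k => ENNReal.ofReal (diffQuot m g (dyadicCell k a b t))) atTop ∂μ := by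
    refine lintegral_congr_ae ?_
    filter_upwards [hM.ae_tendsto_diffQuot hab hμ, hsupp] with t h1 h2
    exact (ENNReal.tendsto_ofReal (h1 h2)).liminf_eq.symm
  rw [hlim]
  refine (lintegral_liminf_le fun k =>
    ((stronglyMeasurable_dyadicCell _ k a b).measurable.ennreal_ofReal)).trans_lt ?_
  refine lt_of_le_of_lt ?_ (ENNReal.ofReal_lt_top (r := m b - m a))
  refine liminf_le_of_le (by isBoundedDefault) fun x hx => ?_
  obtain ⟨k, hk⟩ := hx.exists
  refine hk.trans ?_
  have := lintegral_diffQuot_dyadicCell_le hμ hm k le_rfl hab le_rfl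
  rwa [hres] at this

end Measure

section Regulated

open MeasureTheory

/-- `y` has finite one-sided limits at every real point. -/
def HasOneSidedLimits {E : Type*} [TopologicalSpace E] (y : ℝ → E) : Prop :=
  ∀ t, (∃ L, Tendsto y (𝓝[<] t) (𝓝 L)) ∧ ∃ L, Tendsto y (𝓝[>] t) (𝓝 L)

theorem HasOneSidedLimits.regulatedOn {E : Type*} [NormedAddCommGroup E] {y : ℝ → E}
    (h : HasOneSidedLimits y) (a b : ℝ) : RegulatedOn y a b :=
  ⟨fun t _ => (h t).1.imp fun _ hL => hL.mono_left (nhdsWithin_mono t fun _ hs => hs.2),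
    fun t _ => (h t).2.imp fun _ hL => hL.mono_left (nhdsWithin_mono t fun _ hs => hs.1)⟩

theorem HasOneSidedLimits.exists_countable_continuousAt {E : Type*} [PseudoMetricSpace E]
    {y : ℝ → E} (h : HasOneSidedLimits y) :
    ∃ S : Set ℝ, S.Countable ∧ ∀ t ∉ S, ContinuousAt y t := by
  have key : ∀ (n : ℕ) (t : ℝ), ∃ δ > 0,
      (∀ s ∈ Ioo (t - δ) t, ∀ s' ∈ Ioo (t - δ) t, dist (y s) (y s') < 1 / ((n : ℝ) + 1)) ∧
      ∀ s ∈ Ioo t (t + δ), ∀ s' ∈ Ioo t (t + δ), dist (y s) (y s') < 1 / ((n : ℝ) + 1) := by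
    intro n t
    have hn : (0 : ℝ) < 1 / ((n : ℝ) + 1) / 2 := half_pos Nat.one_div_pos_of_nat
    obtain ⟨⟨L, hL⟩, L', hL'⟩ := h t
    obtain ⟨l, hl, hl'⟩ := (mem_nhdsLT_iff_exists_Ioo_subset).1 (hL (Metric.ball_mem_nhds L hn))
    obtain ⟨r, hr, hr'⟩ := (mem_nhdsGT_iff_exists_Ioo_subset).1 (hL' (Metric.ball_mem_nhds L' hn))
    have hlt : l < t := hl
    have htr : t < r := hr
    refine ⟨min (t - l) (r - t), lt_min (by linarith) (by linarith), ?_, ?_⟩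
    · intro s hs s' hs'
      have := min_le_left (t - l) (r - t)
      have h1 : dist (y s) L < _ := hl' ⟨by linarith [hs.1], hs.2⟩
      have h2 : dist (y s') L < _ := hl' ⟨by linarith [hs'.1], hs'.2⟩
      linarith [dist_triangle_right (y s) (y s') L]
    · intro s hs s' hs'
      have := min_le_right (t - l) (r - t)
      have h1 : dist (y s) L' < _ := hr' ⟨hs.1, by linarith [hs.2]⟩
      have h2 : dist (y s') L' < _ := hr' ⟨hs'.1, by linarith [hs'.2]⟩
      linarith [dist_triangle_right (y s) (y s') L']
  choose δ hδ hleft hright using key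
  choose S hS hcov using fun n => TopologicalSpace.countable_cover_nhds
    (f := fun t => Ioo (t - δ n t) (t + δ n t))
    fun t => Ioo_mem_nhds (by linarith [hδ n t]) (by linarith [hδ n t])
  refine ⟨⋃ n, S n, countable_iUnion hS, fun t ht => Metric.continuousAt_iff'.2 fun ε hε => ?_⟩
  obtain ⟨n, hn⟩ := exists_nat_one_div_lt hε
  have htU : t ∈ ⋃ x ∈ S n, Ioo (x - δ n x) (x + δ n x) := by rw [hcov n]; trivial
  simp only [mem_iUnion, exists_prop, not_exists] at htU ht
  obtain ⟨x, hx, htx⟩ := htU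
  rcases lt_trichotomy t x with hlt | rfl | hlt
  · filter_upwards [Ioo_mem_nhds htx.1 hlt] with s hs
    exact (hleft n x s hs t ⟨htx.1, hlt⟩).trans hn
  · exact absurd hx (ht n)
  · filter_upwards [Ioo_mem_nhds hlt htx.2] with s hs
    exact (hright n x s hs t ⟨hlt, htx.2⟩).trans hn

theorem HasOneSidedLimits.measurable {E : Type*} [PseudoMetricSpace E] [MeasurableSpace E]
    [BorelSpace E] {y : ℝ → E} (h : HasOneSidedLimits y) : Measurable y := by
  obtain ⟨S, hS, hc⟩ := h.exists_countable_continuousAt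
  have := hS.to_subtype
  refine measurable_of_restrict_of_restrict_compl hS.measurableSet (measurable_of_countable _) ?_
  have hco : ContinuousOn y Sᶜ := fun t ht => (hc t ht).continuousWithinAt
  exact hco.domRestrict.measurable

theorem hasOneSidedLimits_of_norm_sub_le {E : Type*} [NormedAddCommGroup E] [CompleteSpace E]
    {y : ℝ → E} {m : ℝ → ℝ} (hm : Monotone m) (h : ∀ s t, s ≤ t → ‖y t - y s‖ ≤ m t - m s) :
    HasOneSidedLimits y := by
  have h' : ∀ s t, dist (y s) (y t) ≤ dist (m s) (m t) := by
    intro s t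
    rcases le_total s t with hst | hst
    · rw [dist_comm, dist_eq_norm, dist_comm, Real.dist_eq]
      exact (h s t hst).trans (le_abs_self _)
    · rw [dist_eq_norm, Real.dist_eq]
      exact (h t s hst).trans (le_abs_self _)
  have key : ∀ (l : Filter ℝ) [l.NeBot] (L : ℝ), Tendsto m l (𝓝 L) → ∃ L', Tendsto y l (𝓝 L') := by
    intro l _ L hL
    refine cauchy_map_iff_exists_tendsto.1 ((Metric.cauchy_iff).2 ⟨inferInstance, fun ε hε => ?_⟩)
    obtain ⟨u, hu, hu'⟩ := (Metric.cauchy_iff.1 hL.cauchy_map).2 ε hε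
    exact ⟨y '' (m ⁻¹' u), image_mem_map hu, by
      rintro _ ⟨s, hs, rfl⟩ _ ⟨t, ht, rfl⟩
      exact (h' s t).trans_lt (hu' _ hs _ ht)⟩
  exact fun t => ⟨key _ _ (hm.tendsto_leftLim t), key _ _ (hm.tendsto_rightLim t)⟩

end Regulated

section Caratheodory

open MeasureTheory

theorem aestronglyMeasurable_comp_of_ae_continuous {α E G : Type*} [MeasurableSpace α]
    {μ : Measure α} [TopologicalSpace E] [NormedAddCommGroup G]
    {F : α → E → G} (hcont : ∀ᵐ s ∂μ, Continuous (F s))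
    (hmeas : ∀ u, AEStronglyMeasurable (fun s => F s u) μ) {x : α → E}
    (hx : StronglyMeasurable x) : AEStronglyMeasurable (fun s => F s (x s)) μ := by
  refine aestronglyMeasurable_of_tendsto_ae atTop (f := fun k s => F s (hx.approx k s))
    (fun k => ?_) ?_
  · classical
    have hsum : (fun s => F s (hx.approx k s)) = fun s => ∑ v ∈ (hx.approx k).range,
        (hx.approx k ⁻¹' {v}).indicator (fun s => F s v) s := by
      funext s
      rw [Finset.sum_eq_single (hx.approx k s)]
      · rw [indicator_of_mem (by simp)]
      · intro v _ hv
        exact indicator_of_notMem (fun hs => hv hs.symm) _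
      · intro hs
        exact absurd (SimpleFunc.mem_range_self _ _) hs
    rw [hsum]
    exact Finset.aestronglyMeasurable_fun_sum _ fun v _ =>
      (hmeas v).indicator ((hx.approx k).measurableSet_fiber v)
  · filter_upwards [hcont] with s hs
    exact (hs.tendsto _).comp (hx.tendsto_approx s)

theorem ae_forall_norm_le {α E G : Type*} [MeasurableSpace α] {μ : Measure α}
    [TopologicalSpace E] [TopologicalSpace.SeparableSpace E] [Nonempty E] [NormedAddCommGroup G]
    {F : α → E → G} {M : α → ℝ} (hcont : ∀ᵐ s ∂μ, Continuous (F s))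
    (h : ∀ u, ∀ᵐ s ∂μ, ‖F s u‖ ≤ M s) : ∀ᵐ s ∂μ, ∀ u, ‖F s u‖ ≤ M s := by
  have hd : ∀ᵐ s ∂μ, ∀ n, ‖F s (TopologicalSpace.denseSeq E n)‖ ≤ M s :=
    ae_all_iff.2 fun n => h _
  filter_upwards [hcont, hd] with s hs hsd u
  exact (TopologicalSpace.denseRange_denseSeq E).induction_on (p := fun u => ‖F s u‖ ≤ M s) u
    (isClosed_le hs.norm continuous_const) hsd

end Caratheodory

section Selection

/-- A Helly-type selection theorem: a sequence of bounded functions dominated by the increments of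
one monotone function has a pointwise convergent subsequence. -/
theorem exists_subseq_tendsto_of_norm_sub_le {E : Type*} [NormedAddCommGroup E] [ProperSpace E]
    {w : ℕ → ℝ → E} {m : ℝ → ℝ} (C : ℝ)
    (hw : ∀ k s t, s ≤ t → ‖w k t - w k s‖ ≤ m t - m s) (hC : ∀ k t, ‖w k t‖ ≤ C) :
    ∃ (φ : ℕ → ℕ) (x : ℝ → E), StrictMono φ ∧
      ∀ t, Tendsto (fun j => w (φ j) t) atTop (𝓝 (x t)) := by
  have hw' : ∀ k s t, dist (w k s) (w k t) ≤ dist (m s) (m t) := by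
    intro k s t
    rcases le_total s t with hst | hst
    · rw [dist_comm, dist_eq_norm, dist_comm, Real.dist_eq]
      exact (hw k s t hst).trans (le_abs_self _)
    · rw [dist_eq_norm, Real.dist_eq]
      exact (hw k t s hst).trans (le_abs_self _)
  obtain ⟨D, hDc, hD⟩ : ∃ D : Set ℝ, D.Countable ∧ ∀ t, ∀ ε > 0, ∃ d ∈ D, dist (m t) (m d) < ε := by
    obtain ⟨S, hS, hSd⟩ := TopologicalSpace.exists_countable_dense (range m)
    choose p hp using fun q : range m => q.2
    refine ⟨p '' S, hS.image p, fun t ε hε => ?_⟩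
    obtain ⟨q, hq, hdist⟩ := hSd.exists_dist_lt ⟨m t, t, rfl⟩ hε
    exact ⟨p q, mem_image_of_mem p hq, by rw [hp q]; exact hdist⟩
  have := hDc.to_subtype
  obtain ⟨z, -, φ, hφ, hlim⟩ := (isCompact_univ_pi fun _ : D =>
    isCompact_closedBall (0 : E) C).tendsto_subseq (x := fun k (d : D) => w k d)
    fun k d _ => by simpa using hC k d
  have hcauchy : ∀ t, CauchySeq fun j => w (φ j) t := by
    intro t
    refine Metric.cauchySeq_iff.2 fun ε hε => ?_
    obtain ⟨d, hd, hdist⟩ := hD t (ε / 3) (by positivity)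
    have hcd : CauchySeq fun j => w (φ j) d := (tendsto_pi_nhds.1 hlim ⟨d, hd⟩).cauchySeq
    obtain ⟨N, hN⟩ := Metric.cauchySeq_iff.1 hcd (ε / 3) (by positivity)
    refine ⟨N, fun i hi j hj => ?_⟩
    have h1 := hw' (φ i) t d
    have h2 := hw' (φ j) t d
    have h3 := hN i hi j hj
    have h4 := dist_triangle4 (w (φ i) t) (w (φ i) d) (w (φ j) d) (w (φ j) t)
    rw [dist_comm (w (φ j) d) (w (φ j) t)] at h4
    linarith
  choose x hx using fun t => cauchySeq_tendsto_of_complete (hcauchy t)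
  exact ⟨φ, x, hφ, hx⟩

end Selection

section Resolvent

variable {E : Type*} [NormedAddCommGroup E]

/-- `φ` is a strict comparison function for the nonlinear contraction `T`. -/
def IsContraction (φ : ℝ → ℝ) (T : E → E) : Prop := ∀ u v, ‖T u - T v‖ ≤ φ ‖u - v‖

theorem IsContraction.norm_sub_lt {φ : ℝ → ℝ} (hφlt : ∀ t, 0 < t → φ t < t) {T : E → E}
    (hT : IsContraction φ T) {u v : E} (huv : u ≠ v) : ‖T u - T v‖ < ‖u - v‖ :=
  (hT u v).trans_lt (hφlt _ (norm_pos_iff.2 (sub_ne_zero.2 huv)))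

theorem IsContraction.continuous {φ : ℝ → ℝ} (hφlt : ∀ t, 0 < t → φ t < t) {T : E → E}
    (hT : IsContraction φ T) : Continuous T := by
  refine (LipschitzWith.of_dist_le_mul (K := 1) fun u v => ?_).continuous
  rcases eq_or_ne u v with rfl | huv
  · simp
  · simpa [dist_eq_norm] using (hT.norm_sub_lt hφlt huv).le

theorem IsContraction.eq_of_fixed {φ : ℝ → ℝ} (hφlt : ∀ t, 0 < t → φ t < t) {T : E → E}
    (hT : IsContraction φ T) {u v : E} (hu : T u = u) (hv : T v = v) : u = v := by
  by_contra huv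
  have := hT.norm_sub_lt hφlt huv
  rw [hu, hv] at this
  exact lt_irrefl _ this

theorem IsContraction.exists_fixed_mem_closedBall [ProperSpace E] {φ : ℝ → ℝ}
    (hφ : MonotoneOn φ (Ici 0)) (hφlt : ∀ t, 0 < t → φ t < t) {T : E → E}
    (hT : IsContraction φ T) {z : E} {r : ℝ} (hr : 0 ≤ r) (hz : ‖T z - z‖ ≤ r - φ r) :
    ∃ u ∈ Metric.closedBall z r, T u = u := by
  have hmaps : ∀ u ∈ Metric.closedBall z r, T u ∈ Metric.closedBall z r := by
    intro u hu
    rw [mem_closedBall_iff_norm] at hu ⊢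
    have h1 := hT u z
    have h2 := hφ (norm_nonneg (u - z)) hr hu
    have h3 := norm_sub_le_norm_sub_add_norm_sub (T u) (T z) z
    linarith
  obtain ⟨u, hu, hmin⟩ := (isCompact_closedBall z r).exists_isMinOn
    ⟨z, Metric.mem_closedBall_self hr⟩ (f := fun u => ‖T u - u‖)
    (((hT.continuous hφlt).sub continuous_id).norm.continuousOn)
  refine ⟨u, hu, by_contra fun hne => ?_⟩
  exact absurd (hmin (hmaps u hu)) (not_le.2 (hT.norm_sub_lt hφlt hne))

/-- Adding a constant preserves the contraction property. -/
theorem IsContraction.add_const {φ : ℝ → ℝ} {T : E → E} (hT : IsContraction φ T) (w : E) :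
    IsContraction φ fun u => T u + w := fun u v => by simpa using hT u v

theorem exists_le_sub_of_liminf_lt_one {φ : ℝ → ℝ}
    (hliminf : liminf (fun r : ℝ => φ r / r) atTop < 1) (hφlt : ∀ t, 0 < t → φ t < t) (K : ℝ) :
    ∃ r, 0 ≤ r ∧ K ≤ r - φ r := by
  obtain ⟨c, hc, hc1⟩ := exists_between hliminf
  have hcob : IsCoboundedUnder (· ≥ ·) atTop fun r : ℝ => φ r / r := by
    refine IsBoundedUnder.isCoboundedUnder_ge ⟨1, ?_⟩
    rw [eventually_map]
    filter_upwards [eventually_gt_atTop 0] with r hr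
    exact (div_le_one hr).2 (hφlt r hr).le
  have hfr := frequently_lt_of_liminf_lt hcob hc
  obtain ⟨r, hr, hr0, hrK⟩ := (hfr.and_eventually
    ((eventually_gt_atTop 0).and (eventually_ge_atTop (K / (1 - c))))).exists
  rw [div_lt_iff₀ hr0] at hr
  rw [div_le_iff₀ (by linarith)] at hrK
  exact ⟨r, hr0.le, by nlinarith⟩

theorem norm_sub_le_of_resolvent [ProperSpace E] {φ : ℝ → ℝ}
    (hφ : MonotoneOn φ (Ici 0)) (hφlt : ∀ t, 0 < t → φ t < t) {T : E → E}
    (hT : IsContraction φ T) {u u' w w' : E} (hu : T u + w = u) (hu' : T u' + w' = u')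
    {ε : ℝ} (hε : 0 ≤ ε) (hw : ‖w' - w‖ ≤ ε - φ ε) : ‖u' - u‖ ≤ ε := by
  obtain ⟨v, hv, hfix⟩ := (hT.add_const w').exists_fixed_mem_closedBall hφ hφlt (z := u) hε (by
    have : T u + w' - u = w' - w := by nth_rewrite 2 [← hu]; abel
    rwa [this])
  rw [(hT.add_const w').eq_of_fixed hφlt hu' hfix]
  exact mem_closedBall_iff_norm.1 hv

/-- Solutions `u` of `T s u + w s = u` depend continuously on the data. -/
theorem tendsto_resolvent [ProperSpace E] {ι : Type*} {l : Filter ι} {φ : ℝ → ℝ}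
    (hφ : MonotoneOn φ (Ici 0)) (hφlt : ∀ t, 0 < t → φ t < t) {T : ι → E → E} {T₀ : E → E}
    (hT : ∀ s, IsContraction φ (T s)) {u w : ι → E} {u₀ w₀ : E} (hu : ∀ s, T s (u s) + w s = u s)
    (hu₀ : T₀ u₀ + w₀ = u₀) (hTlim : Tendsto (fun s => T s u₀) l (𝓝 (T₀ u₀)))
    (hw : Tendsto w l (𝓝 w₀)) : Tendsto u l (𝓝 u₀) := by
  have hlim : Tendsto (fun s => ‖w s - (u₀ - T s u₀)‖) l (𝓝 0) := by
    have h := (hw.sub (hTlim.const_sub u₀)).norm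
    have h0 : w₀ - (u₀ - T₀ u₀) = 0 := by nth_rewrite 1 [← hu₀]; abel
    rwa [h0, norm_zero] at h
  refine Metric.tendsto_nhds.2 fun ε hε => ?_
  have hε2 := half_pos hε
  filter_upwards [hlim.eventually (gt_mem_nhds (sub_pos.2 (hφlt _ hε2)))] with s hs
  rw [dist_eq_norm]
  refine (norm_sub_le_of_resolvent hφ hφlt (hT s) (w := u₀ - T s u₀) (by abel) (hu s) hε2.le
    hs.le).trans_lt (half_lt_self hε)

theorem exists_resolvent [ProperSpace E] {ι : Type*} {φ : ℝ → ℝ} (hφ : MonotoneOn φ (Ici 0))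
    (hφlt : ∀ t, 0 < t → φ t < t)
    (hliminf : liminf (fun r : ℝ => φ r / r) atTop < 1) {T : ι → E → E}
    (hT : ∀ s, IsContraction φ (T s)) : ∃ R : ι → E → E, ∀ s w, T s (R s w) + w = R s w := by
  have h : ∀ s w, ∃ u, T s u + w = u := by
    intro s w
    obtain ⟨r, hr, hK⟩ := exists_le_sub_of_liminf_lt_one hliminf hφlt ‖T s 0 + w - 0‖
    obtain ⟨u, -, hu⟩ := ((hT s).add_const w).exists_fixed_mem_closedBall hφ hφlt hr hK
    exact ⟨u, hu⟩
  choose R hR using h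
  exact ⟨R, hR⟩

/-- The resolvent of a regulated family of contractions preserves one-sided limits. -/
theorem hasOneSidedLimits_resolvent [ProperSpace E] {φ : ℝ → ℝ} (hφ : MonotoneOn φ (Ici 0))
    (hφlt : ∀ t, 0 < t → φ t < t)
    (hliminf : liminf (fun r : ℝ => φ r / r) atTop < 1) {T : ℝ → E → E}
    (hT : ∀ s, IsContraction φ (T s)) (hreg : ∀ v, HasOneSidedLimits fun s => T s v)
    {u w : ℝ → E} (hu : ∀ s, T s (u s) + w s = u s) (hw : HasOneSidedLimits w) :
    HasOneSidedLimits u := by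
  have key : ∀ (l : Filter ℝ) [l.NeBot], (∀ v, ∃ L, Tendsto (fun s => T s v) l (𝓝 L)) →
      (∃ L, Tendsto w l (𝓝 L)) → ∃ L, Tendsto u l (𝓝 L) := by
    rintro l _ hl ⟨w₀, hw₀⟩
    choose T₀ hT₀ using hl
    have hcontr : IsContraction φ T₀ := fun v v' =>
      le_of_tendsto' ((hT₀ v).sub (hT₀ v')).norm fun s => hT s v v'
    obtain ⟨R, hR⟩ := exists_resolvent hφ hφlt hliminf (T := fun _ : Unit => T₀)
      fun _ => hcontr
    exact ⟨R () w₀, tendsto_resolvent hφ hφlt hT hu (hR () w₀) (hT₀ _) hw₀⟩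
  exact fun t => ⟨key _ (fun v => (hreg v t).1) (hw t).1, key _ (fun v => (hreg v t).2) (hw t).2⟩

end Resolvent


section IntegralEquation

open MeasureTheory

theorem integrable_comp_of_norm_sub_le {E : Type*} [NormedAddCommGroup E] [ProperSpace E]
    {μ : Measure ℝ} {F : ℝ → E → E} {M : ℝ → ℝ} (hcont : ∀ᵐ s ∂μ, Continuous (F s))
    (hmeas : ∀ u, AEStronglyMeasurable (fun s => F s u) μ)
    (hM : Integrable M μ) (hFM : ∀ᵐ s ∂μ, ∀ u, ‖F s u‖ ≤ M s) {y : ℝ → E} {m : ℝ → ℝ}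
    (hm : Monotone m) (hy : ∀ s t, s ≤ t → ‖y t - y s‖ ≤ m t - m s) {η : ℝ} :
    Integrable (fun s => F s (y (s - η))) μ := by
  borelize E
  have hmeas_y : Measurable y := (hasOneSidedLimits_of_norm_sub_le hm hy).measurable
  have hsm : StronglyMeasurable fun s => y (s - η) :=
    (hmeas_y.comp (measurable_id.sub_const η)).stronglyMeasurable
  refine hM.mono' (aestronglyMeasurable_comp_of_ae_continuous hcont hmeas hsm) ?_
  filter_upwards [hFM] with s hs using hs _

variable {E : Type*} [NormedAddCommGroup E] [NormedSpace ℝ E]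
  {μ : Measure ℝ} {F : ℝ → E → E} {M : ℝ → ℝ}

theorem monotone_setIntegral_Ico (hM : Integrable M μ) (hM0 : 0 ≤ᵐ[μ] M) (a : ℝ) :
    Monotone fun t => ∫ s in Ico a t, M s ∂μ := fun _ _ hst =>
  setIntegral_mono_set hM.integrableOn (ae_restrict_of_ae hM0)
    (Ico_subset_Ico_right hst).eventuallyLE

theorem norm_setIntegral_Ico_sub_le {G : ℝ → E} (hM : Integrable M μ)
    (hG : Integrable G μ) (hGM : ∀ᵐ s ∂μ, ‖G s‖ ≤ M s) (a : ℝ) {s t : ℝ} (hst : s ≤ t) :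
    ‖∫ r in Ico a t, G r ∂μ - ∫ r in Ico a s, G r ∂μ‖ ≤
      ∫ r in Ico a t, M r ∂μ - ∫ r in Ico a s, M r ∂μ := by
  rcases le_total a s with has | hsa
  · rw [setIntegral_Ico_sub hG has hst, setIntegral_Ico_sub hM has hst]
    exact norm_integral_le_of_norm_le hM.integrableOn (ae_restrict_of_ae hGM)
  · rw [Ico_eq_empty (not_lt.2 hsa)]
    simpa using norm_integral_le_of_norm_le hM.integrableOn (ae_restrict_of_ae hGM)

variable [ProperSpace E]

/-- The delayed integral equation has a global solution. -/
theorem exists_delayed_solution (hcont : ∀ᵐ s ∂μ, Continuous (F s))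
    (hmeas : ∀ u, AEStronglyMeasurable (fun s => F s u) μ) (hM : Integrable M μ)
    (hM0 : 0 ≤ᵐ[μ] M) (hFM : ∀ᵐ s ∂μ, ∀ u, ‖F s u‖ ≤ M s) {a b : ℝ}
    (hsupp : ∀ᵐ s ∂μ, s ∈ Ico a b) (c : E) {η : ℝ} (hη : 0 < η) :
    ∃ y : ℝ → E, (∀ s t, s ≤ t →
        ‖y t - y s‖ ≤ ∫ r in Ico a t, M r ∂μ - ∫ r in Ico a s, M r ∂μ) ∧
      ∀ t, y t = c + ∫ s in Ico a t, F s (y (s - η)) ∂μ := by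
  set m : ℝ → ℝ := fun t => ∫ r in Ico a t, M r ∂μ with hm
  have hmono : Monotone m := monotone_setIntegral_Ico hM hM0 a
  obtain ⟨Φ, hΦ⟩ : ∃ Φ : (ℝ → E) → ℝ → E,
      ∀ y t, Φ y t = c + ∫ s in Ico a t, F s (y (s - η)) ∂μ := ⟨_, fun _ _ => rfl⟩
  have hlip : ∀ y : ℝ → E, (∀ s t, s ≤ t → ‖y t - y s‖ ≤ m t - m s) →
      ∀ s t, s ≤ t → ‖Φ y t - Φ y s‖ ≤ m t - m s := by
    intro y hy s t hst
    rw [hΦ, hΦ, add_sub_add_left_eq_sub]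
    refine norm_setIntegral_Ico_sub_le hM
      (integrable_comp_of_norm_sub_le hcont hmeas hM hFM hmono hy) ?_ a hst
    filter_upwards [hFM] with r hr using hr _
  have hiter : ∀ j : ℕ, ∀ s t, s ≤ t →
      ‖Φ^[j] (fun _ => c) t - Φ^[j] (fun _ => c) s‖ ≤ m t - m s := by
    intro j
    induction j with
    | zero => exact fun s t hst => by simpa using hmono hst
    | succ j ih =>
      rw [Function.iterate_succ_apply']
      exact hlip _ ih
  have hstep : ∀ (j : ℕ) (t : ℝ), Φ^[j + 1] (fun _ => c) t =
      c + ∫ s in Ico a t, F s (Φ^[j] (fun _ => c) (s - η)) ∂μ := fun j t => by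
    rw [Function.iterate_succ_apply', hΦ]
  have hstab : ∀ j : ℕ, ∀ t ≤ a + j * η,
      Φ^[j + 1] (fun _ => c) t = Φ^[j] (fun _ => c) t := by
    intro j
    induction j with
    | zero =>
      intro t ht
      simp only [CharP.cast_eq_zero, zero_mul, add_zero] at ht
      simp [hΦ, Ico_eq_empty (not_lt.2 ht)]
    | succ j ih =>
      intro t ht
      rw [hstep, hstep]
      congr 1
      refine setIntegral_congr_fun measurableSet_Ico fun s hs => ?_
      push_cast at ht
      exact congrArg (F s) (ih (s - η) (by linarith [hs.2]))
  obtain ⟨N, hN⟩ := exists_nat_ge ((b - a) / η)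
  rw [div_le_iff₀ hη] at hN
  refine ⟨Φ^[N + 1] fun _ => c, hiter _, fun t => ?_⟩
  rw [hstep]
  congr 1
  refine integral_congr_ae (ae_restrict_of_ae ?_)
  filter_upwards [hsupp] with s hs
  rw [hstab N (s - η) (by linarith [hs.2])]

/-- A Carathéodory existence theorem for integral equations driven by a finite measure. -/
theorem exists_integral_equation_solution (hcont : ∀ᵐ s ∂μ, Continuous (F s))
    (hmeas : ∀ u, AEStronglyMeasurable (fun s => F s u) μ) (hM : Integrable M μ)
    (hM0 : 0 ≤ᵐ[μ] M) (hFM : ∀ᵐ s ∂μ, ∀ u, ‖F s u‖ ≤ M s) {a b : ℝ}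
    (hsupp : ∀ᵐ s ∂μ, s ∈ Ico a b) (c : E) :
    ∃ w : ℝ → E, HasOneSidedLimits w ∧ ∀ t, w t = c + ∫ s in Ico a t, F s (w s) ∂μ := by
  set m : ℝ → ℝ := fun t => ∫ r in Ico a t, M r ∂μ with hm
  have hmono : Monotone m := monotone_setIntegral_Ico hM hM0 a
  choose y hylip hy using fun k : ℕ => exists_delayed_solution hcont hmeas hM hM0 hFM hsupp c
    (Nat.one_div_pos_of_nat (α := ℝ) (n := k))
  have hbound : ∀ k t, ‖y k t‖ ≤ ‖c‖ + ∫ r, M r ∂μ := by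
    intro k t
    rw [hy k t]
    refine (norm_add_le _ _).trans (add_le_add le_rfl ?_)
    refine (norm_integral_le_of_norm_le hM.integrableOn (ae_restrict_of_ae ?_)).trans
      (setIntegral_le_integral hM hM0)
    filter_upwards [hFM] with r hr using hr _
  obtain ⟨φ, w, hφ, hw⟩ := exists_subseq_tendsto_of_norm_sub_le _ hylip hbound
  have hwlip : ∀ s t, s ≤ t → ‖w t - w s‖ ≤ m t - m s := fun s t hst =>
    le_of_tendsto' ((hw t).sub (hw s)).norm fun j => hylip _ s t hst
  refine ⟨w, hasOneSidedLimits_of_norm_sub_le hmono hwlip, fun t => ?_⟩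
  have hη : Tendsto (fun j => 1 / ((φ j : ℝ) + 1)) atTop (𝓝 0) :=
    tendsto_one_div_add_atTop_nhds_zero_nat.comp hφ.tendsto_atTop
  have hmlim : ∀ s, Tendsto (fun j => m (s - 1 / ((φ j : ℝ) + 1))) atTop (𝓝 (m s)) := by
    intro s
    have hU : ⋃ j, Ico a (s - 1 / ((φ j : ℝ) + 1)) = Ico a s := by
      ext r
      simp only [mem_iUnion, mem_Ico]
      constructor
      · rintro ⟨j, hr, hrs⟩
        have : (0 : ℝ) < 1 / ((φ j : ℝ) + 1) := Nat.one_div_pos_of_nat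
        exact ⟨hr, by linarith⟩
      · rintro ⟨hr, hrs⟩
        obtain ⟨j, hj⟩ := (hη.eventually (gt_mem_nhds (sub_pos.2 hrs))).exists
        exact ⟨j, hr, by linarith⟩
    rw [hm]
    simp only
    rw [← hU]
    refine tendsto_setIntegral_of_monotone (fun _ => measurableSet_Ico) ?_ hM.integrableOn
    intro i j hij
    refine Ico_subset_Ico_right (sub_le_sub_left ?_ _)
    exact Nat.one_div_le_one_div (hφ.monotone hij)
  have hydelay : ∀ s, Tendsto (fun j => y (φ j) (s - 1 / ((φ j : ℝ) + 1))) atTop (𝓝 (w s)) := by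
    intro s
    have h0 : Tendsto (fun j => y (φ j) s - y (φ j) (s - 1 / ((φ j : ℝ) + 1))) atTop (𝓝 0) := by
      refine squeeze_zero_norm (fun j => hylip _ _ _ ?_) (by simpa using (hmlim s).const_sub (m s))
      have : (0 : ℝ) < 1 / ((φ j : ℝ) + 1) := Nat.one_div_pos_of_nat
      linarith
    simpa using (hw s).sub h0
  refine tendsto_nhds_unique (hw t) ?_
  simp_rw [hy _ t]
  refine tendsto_const_nhds.add (tendsto_integral_of_dominated_convergence M (fun j => ?_)
    hM.integrableOn (fun j => ?_) ?_)
  · exact (integrable_comp_of_norm_sub_le hcont hmeas hM hFM hmono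
      (hylip (φ j))).aestronglyMeasurable.restrict
  · refine ae_restrict_of_ae ?_
    filter_upwards [hFM] with s hs using hs _
  · refine ae_restrict_of_ae ?_
    filter_upwards [hcont] with s hs using (hs.tendsto _).comp (hydelay s)

end IntegralEquation

section Clamping

open MeasureTheory

/-- The retraction of the real line onto `[a, b]`. -/
def clamp (a b t : ℝ) : ℝ := max a (min b t)

theorem clamp_mem {a b : ℝ} (hab : a ≤ b) (t : ℝ) : clamp a b t ∈ Icc a b :=
  ⟨le_max_left _ _, max_le hab (min_le_left _ _)⟩

theorem clamp_of_mem {a b t : ℝ} (ht : t ∈ Icc a b) : clamp a b t = t := by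
  rw [clamp, min_eq_right ht.2, max_eq_right ht.1]

theorem monotone_clamp (a b : ℝ) : Monotone (clamp a b) := fun _ _ hst =>
  max_le_max le_rfl (min_le_min le_rfl hst)

theorem clamp_of_le {a b t : ℝ} (hab : a ≤ b) (ht : t ≤ a) : clamp a b t = a := by
  rw [clamp, min_eq_right (ht.trans hab), max_eq_left ht]

theorem clamp_of_ge {a b t : ℝ} (hab : a ≤ b) (ht : b ≤ t) : clamp a b t = b := by
  rw [clamp, min_eq_left ht, max_eq_right hab]

theorem tendsto_clamp_nhdsLT {a b t : ℝ} (ht : t ∈ Ioc a b) :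
    Tendsto (clamp a b) (𝓝[<] t) (𝓝[Ico a t] t) := by
  have h : Ioo a t ∈ 𝓝[<] t := Ioo_mem_nhdsLT ht.1
  refine tendsto_nhdsWithin_iff.2 ⟨?_, ?_⟩
  · refine (tendsto_id.mono_left nhdsWithin_le_nhds).congr' ?_
    filter_upwards [h] with s hs using (clamp_of_mem ⟨hs.1.le, hs.2.le.trans ht.2⟩).symm
  · filter_upwards [h] with s hs
    rw [clamp_of_mem ⟨hs.1.le, hs.2.le.trans ht.2⟩]
    exact ⟨hs.1.le, hs.2⟩

theorem tendsto_clamp_nhdsGT {a b t : ℝ} (ht : t ∈ Ico a b) :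
    Tendsto (clamp a b) (𝓝[>] t) (𝓝[Ioc t b] t) := by
  have h : Ioo t b ∈ 𝓝[>] t := Ioo_mem_nhdsGT ht.2
  refine tendsto_nhdsWithin_iff.2 ⟨?_, ?_⟩
  · refine (tendsto_id.mono_left nhdsWithin_le_nhds).congr' ?_
    filter_upwards [h] with s hs using (clamp_of_mem ⟨ht.1.trans hs.1.le, hs.2.le⟩).symm
  · filter_upwards [h] with s hs
    rw [clamp_of_mem ⟨ht.1.trans hs.1.le, hs.2.le⟩]
    exact ⟨hs.1, hs.2.le⟩

/-- A regulated function on `[a, b]`, extended by constants, has one-sided limits everywhere. -/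
theorem RegulatedOn.hasOneSidedLimits_comp_clamp {E : Type*} [NormedAddCommGroup E] {y : ℝ → E}
    {a b : ℝ} (hab : a ≤ b) (hy : RegulatedOn y a b) :
    HasOneSidedLimits fun t => y (clamp a b t) := by
  refine fun t => ⟨?_, ?_⟩
  · rcases le_or_gt t a with hta | hat
    · refine ⟨y a, tendsto_const_nhds.congr' ?_⟩
      filter_upwards [self_mem_nhdsWithin] with s hs
      rw [clamp_of_le hab ((mem_Iio.1 hs).le.trans hta)]
    · rcases le_or_gt t b with htb | hbt
      · exact (hy.1 t ⟨hat, htb⟩).imp fun L hL => hL.comp (tendsto_clamp_nhdsLT ⟨hat, htb⟩)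
      · refine ⟨y b, tendsto_const_nhds.congr' ?_⟩
        filter_upwards [Ioo_mem_nhdsLT hbt] with s hs
        rw [clamp_of_ge hab hs.1.le]
  · rcases lt_or_ge t a with hta | hat
    · refine ⟨y a, tendsto_const_nhds.congr' ?_⟩
      filter_upwards [Ioo_mem_nhdsGT hta] with s hs
      rw [clamp_of_le hab hs.2.le]
    · rcases lt_or_ge t b with htb | hbt
      · exact (hy.2 t ⟨hat, htb⟩).imp fun L hL => hL.comp (tendsto_clamp_nhdsGT ⟨hat, htb⟩)
      · refine ⟨y b, tendsto_const_nhds.congr' ?_⟩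
        filter_upwards [self_mem_nhdsWithin] with s hs
        rw [clamp_of_ge hab (hbt.trans (mem_Ioi.1 hs).le)]

theorem RegulatedOn.congr {E : Type*} [NormedAddCommGroup E] {y z : ℝ → E} {a b : ℝ}
    (hy : RegulatedOn y a b) (h : EqOn y z (Icc a b)) : RegulatedOn z a b := by
  refine ⟨fun t ht => (hy.1 t ht).imp fun L hL => hL.congr' ?_,
    fun t ht => (hy.2 t ht).imp fun L hL => hL.congr' ?_⟩
  · filter_upwards [self_mem_nhdsWithin] with s hs using h ⟨hs.1, hs.2.le.trans ht.2⟩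
  · filter_upwards [self_mem_nhdsWithin] with s hs using h ⟨ht.1.trans hs.1.le, hs.2⟩

/-- The Lebesgue–Stieltjes measure of a nondecreasing left-continuous function on `[a, b]`. -/
theorem exists_measure_Ico_eq_sub {g : ℝ → ℝ} {a b : ℝ} (hab : a ≤ b)
    (hg : MonotoneOn g (Icc a b)) (hlc : LeftContinuousOn g a b) :
    ∃ μ : Measure ℝ, IsFiniteMeasure μ ∧ (∀ᵐ t ∂μ, t ∈ Ico a b) ∧
      ∀ c d, a ≤ c → c ≤ d → d ≤ b → μ.real (Ico c d) = g d - g c := by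
  have hG : Monotone fun t => g (clamp a b t) := fun s t hst =>
    hg (clamp_mem hab s) (clamp_mem hab t) (monotone_clamp a b hst)
  have hleft : ∀ t ∈ Icc a b, Function.leftLim hG.stieltjesFunction t = g t := by
    intro t ht
    have hlim : Tendsto (fun s => g (clamp a b s)) (𝓝[<] t) (𝓝 (g t)) := by
      rcases ht.1.eq_or_lt with rfl | hat
      · refine tendsto_const_nhds.congr' ?_
        filter_upwards [self_mem_nhdsWithin] with s hs
        rw [clamp_of_le hab (mem_Iio.1 hs).le]
      · exact (hlc t ⟨hat, ht.2⟩).comp (tendsto_clamp_nhdsLT ⟨hat, ht.2⟩)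
    have hfun : (hG.stieltjesFunction : ℝ → ℝ) = Function.rightLim fun s => g (clamp a b s) :=
      funext hG.stieltjesFunction_eq
    rw [hfun, leftLim_rightLim (hG.tendsto_leftLim t), leftLim_eq_of_tendsto hlim]
  refine ⟨hG.stieltjesFunction.measure.restrict (Ico a b), ⟨?_⟩,
    ae_restrict_mem measurableSet_Ico, fun c d hac hcd hdb => ?_⟩
  · rw [Measure.restrict_apply_univ, StieltjesFunction.measure_Ico]
    exact ENNReal.ofReal_lt_top
  · have hsub : Ico c d ∩ Ico a b = Ico c d := inter_eq_left.2 (Ico_subset_Ico hac hdb)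
    rw [measureReal_restrict_apply measurableSet_Ico, hsub, measureReal_def,
      StieltjesFunction.measure_Ico, hleft c ⟨hac, hcd.trans hdb⟩, hleft d ⟨hac.trans hcd, hdb⟩,
      ENNReal.toReal_ofReal]
    exact sub_nonneg.2 (hg ⟨hac, hcd.trans hdb⟩ ⟨hac.trans hcd, hdb⟩ hcd)

end Clamping

/-- Theorem 3.2, existence under (A0)–(A3). -/
theorem existence_of_solutions_A0_A3
    {n : ℕ} (t₀ a : ℝ) (ha : 0 < a)
    (g : ℝ → ℝ) (hg_mono : MonotoneOn g (Set.Icc t₀ (t₀ + a)))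
    (hg_lc : LeftContinuousOn g t₀ (t₀ + a))
    (f h : ℝ → En n → En n) (x₀ : En n)
    (A0 : ∀ t ∈ Set.Icc t₀ (t₀ + a), Continuous (f t))
    (A1 : ∀ u : En n, KSIntegrable (fun s => f s u) g t₀ (t₀ + a))
    (M : ℝ → ℝ)
    (hM_nonneg : ∀ s ∈ Set.Icc t₀ (t₀ + a), 0 ≤ M s)
    (hM_int : KSIntegrable M g t₀ (t₀ + a))
    (A2 : ∀ (u : En n) (c d : ℝ), t₀ ≤ c → c ≤ d → d ≤ t₀ + a →
      ∀ (If : En n) (Im : ℝ), HasKSIntegral (fun s => f s u) g c d If →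
        HasKSIntegral M g c d Im → ‖If‖ ≤ Im)
    (φ : ℝ → ℝ) (hφD : IsDFunction φ) (hφlt : ∀ t : ℝ, 0 < t → φ t < t)
    (A3reg : ∀ v : En n, RegulatedOn (fun t => h t v) t₀ (t₀ + a))
    (A3lip : ∀ t ∈ Set.Icc t₀ (t₀ + a), ∀ u v : En n, ‖h t u - h t v‖ ≤ φ ‖u - v‖)
    (hliminf : Filter.liminf (fun r : ℝ => φ r / r) Filter.atTop < 1) :
    ∃ x : ℝ → En n, IsHMDESolution h f g t₀ a x₀ x := by
  have hab : t₀ ≤ t₀ + a := by linarith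
  have hφ : MonotoneOn φ (Ici 0) := hφD.2.1
  obtain ⟨μ, hfin, hsupp, hμ⟩ := exists_measure_Ico_eq_sub hab hg_mono hg_lc
  have hsupp' : ∀ᵐ s ∂μ, s ∈ Icc t₀ (t₀ + a) := hsupp.mono fun s hs => Ico_subset_Icc_self hs
  obtain ⟨Im, hIm⟩ := hM_int
  obtain ⟨m, hm⟩ := hIm.exists_isVariationalPrimitive hab
  choose P hP using fun u => (A1 u).exists_isVariationalPrimitive hab
  have hPm : ∀ u c d, t₀ ≤ c → c ≤ d → d ≤ t₀ + a → ‖P u d - P u c‖ ≤ m d - m c :=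
    fun u c d hc hcd hd =>
      A2 u c d hc hcd hd _ _ ((hP u).hasKSIntegral hc hcd hd) (hm.hasKSIntegral hc hcd hd)
  have hm_mono : MonotoneOn m (Icc t₀ (t₀ + a)) := fun c hc d hd hcd =>
    sub_nonneg.1 ((norm_nonneg _).trans (hPm 0 c d hc.1 hcd hd.2))
  have hM0 : 0 ≤ᵐ[μ] M := hsupp'.mono fun s hs => hM_nonneg s hs
  have hM : MeasureTheory.Integrable M μ := hm.integrable_of_nonneg hab hμ hsupp hm_mono hM0
  have hf_cont : ∀ᵐ s ∂μ, Continuous (f s) := hsupp'.mono A0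
  have hf_meas : ∀ u, MeasureTheory.AEStronglyMeasurable (fun s => f s u) μ := fun u =>
    (hP u).aestronglyMeasurable hab hμ hsupp
  have hf_le : ∀ᵐ s ∂μ, ∀ u, ‖f s u‖ ≤ M s := ae_forall_norm_le hf_cont fun u =>
    (hP u).ae_norm_le hab hμ hsupp hm (hPm u)
  set T : ℝ → En n → En n := fun t => h (clamp t₀ (t₀ + a) t)
  have hTh : ∀ t ∈ Icc t₀ (t₀ + a), T t = h t := fun t ht => congrArg h (clamp_of_mem ht)
  have hTφ : ∀ t, IsContraction φ (T t) := fun t => A3lip _ (clamp_mem hab t)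
  have hTreg : ∀ v, HasOneSidedLimits fun t => T t v := fun v =>
    (A3reg v).hasOneSidedLimits_comp_clamp hab
  obtain ⟨R, hR⟩ := exists_resolvent hφ hφlt hliminf hTφ
  have hR_cont : ∀ s, Continuous (R s) := fun s => continuous_iff_continuousAt.2 fun w₀ =>
    tendsto_resolvent hφ hφlt (fun _ => hTφ s) (fun w => hR s w) (hR s w₀) tendsto_const_nhds
      tendsto_id
  have hR_reg : ∀ {w : ℝ → En n}, HasOneSidedLimits w → HasOneSidedLimits fun s => R s (w s) :=
    fun hw => hasOneSidedLimits_resolvent hφ hφlt hliminf hTφ hTreg (fun s => hR s _) hw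
  have hconst : ∀ u : En n, HasOneSidedLimits fun _ : ℝ => u := fun u _ =>
    ⟨⟨u, tendsto_const_nhds⟩, u, tendsto_const_nhds⟩
  have hcomp_meas : ∀ {w : ℝ → En n}, HasOneSidedLimits w →
      MeasureTheory.AEStronglyMeasurable (fun s => f s (R s (w s))) μ := fun hw =>
    aestronglyMeasurable_comp_of_ae_continuous hf_cont hf_meas
      (hR_reg hw).measurable.stronglyMeasurable
  obtain ⟨w, hw_reg, hw⟩ := exists_integral_equation_solution (F := fun s u => f s (R s u))
    (hf_cont.mono fun s hs => hs.comp (hR_cont s)) (fun u => hcomp_meas (hconst u)) hM hM0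
    (hf_le.mono fun s hs u => hs _) hsupp (x₀ - h t₀ x₀)
  have hint : MeasureTheory.Integrable (fun s => f s (R s (w s))) μ :=
    hM.mono' (hcomp_meas hw_reg) (hf_le.mono fun s hs => hs _)
  have hsub : ∀ t ∈ Icc t₀ (t₀ + a), R t (w t) = h t (R t (w t)) + w t := fun t ht => by
    rw [← hTh t ht, hR]
  have hx_reg := (hR_reg hw_reg).regulatedOn t₀ (t₀ + a)
  have hw_reg' := hw_reg.regulatedOn t₀ (t₀ + a)
  refine ⟨fun t => R t (w t), hx_reg, ?_, ?_,
    fun t => ∫ s in Ico t₀ t, f s (R s (w s)) ∂μ, fun t ht => ?_, fun t ht => ?_⟩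
  · have hfix : T t₀ x₀ + w t₀ = x₀ := by
      rw [hw t₀, hTh t₀ (left_mem_Icc.2 hab)]
      simp
    exact ((hTφ t₀).add_const (w t₀)).eq_of_fixed hφlt (hR t₀ (w t₀)) hfix
  · refine RegulatedOn.congr (y := fun t => R t (w t) - w t) ⟨fun t ht => ?_, fun t ht => ?_⟩
      fun t ht => sub_eq_of_eq_add (hsub t ht)
    · obtain ⟨L, hL⟩ := hx_reg.1 t ht
      obtain ⟨L', hL'⟩ := hw_reg'.1 t ht
      exact ⟨L - L', hL.sub hL'⟩
    · obtain ⟨L, hL⟩ := hx_reg.2 t ht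
      obtain ⟨L', hL'⟩ := hw_reg'.2 t ht
      exact ⟨L - L', hL.sub hL'⟩
  · simpa using (isVariationalPrimitive_of_integrable hμ hint).hasKSIntegral le_rfl ht.1 ht.2
  · have hwt := congrArg (h t (R t (w t)) + ·) (hw t)
    rw [← hsub t ht] at hwt
    exact hwt.trans (by beta_reduce; abel)

end HMDEPaper
end
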